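/- arXiv:1602.06773 — 4 statements merged into one kernel-verified Lean document; each statement's English description precedes it below -/
import Mathlib

section
/- Every finite-dimensional representation of a quiver of type A_n (a quiver whose underlying graph is the linear graph with n vertices, with any orientation of the arrows) is isomorphic to a direct sum of thin indecomposable representations, i.e. to a direct sum of interval representations M([s,t]) with 1 ≤ s ≤ t ≤ n. -/
/-! A minimal framework for representations of a quiver with vertex set `V`,
arrow set `E` and source/target maps `s t : E → V`, over a field `k`. -/

structure QRep (k : Type) [Field k] {V E : Type} (s t : E → V) where
  space : V → Type
  [acg : ∀ v, AddCommGroup (space v)]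
  [mod : ∀ v, Module k (space v)]
  map : ∀ e : E, space (s e) →ₗ[k] space (t e)

attribute [instance] QRep.acg QRep.mod

namespace QRep

variable {k : Type} [Field k] {V E : Type} {s t : E → V}

/-- An isomorphism of representations: compatible linear equivalences at every vertex. -/
structure Iso (M N : QRep k s t) where
  app : ∀ v, M.space v ≃ₗ[k] N.space v
  comm : ∀ (e : E) (x : M.space (s e)), app (t e) (M.map e x) = N.map e (app (s e) x)

/-- The (binary) direct sum of two representations. -/
def prod (M N : QRep k s t) : QRep k s t where
  space v := M.space v × N.space v
  acg v := inferInstanceAs (AddCommGroup (M.space v × N.space v))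
  mod v := inferInstanceAs (Module k (M.space v × N.space v))
  map e := (M.map e).prodMap (N.map e)

/-- The direct sum of an arbitrary family of representations. -/
noncomputable def dsum {ι : Type} (F : ι → QRep k s t) : QRep k s t :=
  letI := Classical.decEq ι
  { space := fun v => DirectSum ι fun i => (F i).space v
    acg := fun v => inferInstanceAs (AddCommGroup (DirectSum ι fun i => (F i).space v))
    mod := fun v => inferInstanceAs (Module k (DirectSum ι fun i => (F i).space v))
    map := fun e => DirectSum.toModule k ι (DirectSum ι fun i => (F i).space (t e))
      fun i => (DirectSum.lof k ι (fun j => (F j).space (t e)) i).comp ((F i).map e) }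

/-- The zero representation predicate. -/
def IsZero (M : QRep k s t) : Prop := ∀ (v : V) (x : M.space v), x = 0

/-- A representation is indecomposable if it is nonzero and any direct sum
decomposition has a zero summand. -/
def Indecomposable (M : QRep k s t) : Prop :=
  ¬ M.IsZero ∧ ∀ N₁ N₂ : QRep k s t, Nonempty (Iso M (N₁.prod N₂)) → N₁.IsZero ∨ N₂.IsZero

/-- A representation is thin if all vertex spaces have dimension at most `1`. -/
def Thin (M : QRep k s t) : Prop := ∀ v : V, Module.rank k (M.space v) ≤ 1

/-- All vertex spaces are finite-dimensional. -/
def FinDim (M : QRep k s t) : Prop := ∀ v : V, FiniteDimensional k (M.space v)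

end QRep

/-- The representation `M(Q)`: the field `k` at every vertex, identity at every arrow. -/
def constRep (k : Type) [Field k] {V E : Type} (s t : E → V) : QRep k s t where
  space _ := k
  acg _ := inferInstanceAs (AddCommGroup k)
  mod _ := inferInstanceAs (Module k k)
  map _ := LinearMap.id

/-- The canonical map `(PLift P → k) → (PLift Q → k)`: the identity if `P` holds
(the two spaces both being `k` then), and zero otherwise. -/
noncomputable def restrictMap (k : Type) [Field k] (P Q : Prop) : (PLift P → k) →ₗ[k] (PLift Q → k) :=
  letI := Classical.propDecidable P
  { toFun := fun v _ => if h : P then v ⟨h⟩ else 0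
    map_add' := by
      intro a b; funext hq; by_cases hP : P <;> simp [hP]
    map_smul' := by
      intro c a; funext hq; by_cases hP : P <;> simp [hP] }

/-- The thin representation `M(Q')` attached to a set `S` of vertices (full subquiver on `S`):
one-dimensional spaces on `S`, zero outside, identity maps on arrows inside `S`,
zero maps elsewhere. -/
noncomputable def subsetRep (k : Type) [Field k] {V E : Type} (s t : E → V) (S : Set V) : QRep k s t where
  space v := PLift (v ∈ S) → k
  acg v := inferInstanceAs (AddCommGroup (PLift (v ∈ S) → k))
  mod v := inferInstanceAs (Module k (PLift (v ∈ S) → k))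
  map e := restrictMap k (s e ∈ S) (t e ∈ S)

/-- The underlying (simple) graph of a quiver. -/
def underlying {V E : Type} (s t : E → V) : SimpleGraph V :=
  SimpleGraph.fromRel fun a b => ∃ e, s e = a ∧ t e = b

/-- The source map of a quiver of type `A_{n+1}`: vertices `Fin (n+1)`, one arrow between
`i` and `i+1` for each `i : Fin n`, oriented according to `d i`. -/
def sA (n : ℕ) (d : Fin n → Bool) : Fin n → Fin (n + 1) :=
  fun e => if d e then e.castSucc else e.succ

/-- The target map of a quiver of type `A_{n+1}`. -/
def tA (n : ℕ) (d : Fin n → Bool) : Fin n → Fin (n + 1) :=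
  fun e => if d e then e.succ else e.castSucc

namespace QRep

section General

variable {k : Type} [Field k] {V E : Type} {s t : E → V}

/-- The subrepresentation given by a stable family of subspaces. -/
def sub (M : QRep k s t) (U : ∀ v, Submodule k (M.space v))
    (hU : ∀ e, ∀ x ∈ U (s e), M.map e x ∈ U (t e)) : QRep k s t where
  space v := U v
  map e := (M.map e).restrict (hU e)

theorem exists_map_of_eq (M : QRep k s t) (e : E) {a b : V} (hs : s e = a) (ht : t e = b) :
    ∃ f : M.space a →ₗ[k] M.space b,
      (∀ w : ∀ x, M.space x, M.map e (w (s e)) = w (t e) ↔ f (w a) = w b) ∧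
      ∀ φ : ∀ x, M.space x →ₗ[k] k, φ (t e) ∘ₗ M.map e = φ (s e) ↔ φ b ∘ₗ f = φ a := by
  subst hs ht
  exact ⟨M.map e, fun _ => Iff.rfl, fun _ => Iff.rfl⟩

theorem dsum_map_apply {ι : Type} (F : ι → QRep k s t) (e : E)
    (z : DirectSum ι fun i => (F i).space (s e)) (i : ι) :
    DirectSum.component k ι (fun i => (F i).space (t e)) i ((dsum F).map e z) =
      (F i).map e (z i) := by
  let := Classical.decEq ι
  let g : (DirectSum ι fun i => (F i).space (s e)) →ₗ[k] DirectSum ι fun i => (F i).space (t e) :=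
    (dsum F).map e
  have hg : ∀ j y, g (DirectSum.lof k ι (fun i => (F i).space (s e)) j y) =
      DirectSum.lof k ι (fun i => (F i).space (t e)) j ((F j).map e y) := fun j y => by
    exact DirectSum.toModule_lof k (M := fun i => (F i).space (s e)) j y
  have h : DirectSum.component k ι _ i ∘ₗ g = (F i).map e ∘ₗ DirectSum.component k ι _ i := by
    refine DirectSum.linearMap_ext k fun j => LinearMap.ext fun y => ?_
    simp only [LinearMap.comp_apply, hg]
    by_cases hij : j = i
    · subst hij
      rw [DirectSum.component.lof_self, DirectSum.component.lof_self]
    · rw [DirectSum.component.of, DirectSum.component.of, dif_neg hij, dif_neg hij, map_zero]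
  exact LinearMap.congr_fun h z

/-- An isomorphism onto a direct sum of subset representations from a system of vectors and
covectors dual to each other. -/
theorem nonempty_iso_dsum_subsetRep (M : QRep k s t) {ι : Type} [Fintype ι] (S : ι → Set V)
    (w : ι → ∀ x, M.space x) (φ : ι → ∀ x, M.space x →ₗ[k] k)
    (hφ : ∀ i, ∀ x ∉ S i, φ i x = 0)
    (hmap : ∀ i e, t e ∈ S i → φ i (t e) ∘ₗ M.map e = φ i (s e))
    (hself : ∀ i, ∀ x ∈ S i, φ i x (w i x) = 1)
    (hne : ∀ i j x, i ≠ j → φ i x (w j x) = 0)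
    (hsum : ∀ x y, ∑ i, φ i x y • w i x = y) :
    Nonempty (Iso M (dsum fun i => subsetRep k s t (S i))) := by
  classical
  let L : ∀ x, M.space x ≃ₗ[k] (∀ i, PLift (x ∈ S i) → k) := fun x =>
    { toFun := fun y i _ => φ i x y
      map_add' := fun _ _ => by ext; simp
      map_smul' := fun _ _ => by ext; simp
      invFun := fun z => ∑ i, (if h : x ∈ S i then z i ⟨h⟩ else 0) • w i x
      left_inv := fun y => by
        conv_rhs => rw [← hsum x y]
        refine Finset.sum_congr rfl fun i _ => ?_
        split_ifs with h
        · rfl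
        · simp [hφ i x h]
      right_inv := fun z => by
        funext i ⟨h⟩
        simp only [map_sum, map_smul]
        rw [Finset.sum_eq_single i (fun j _ hj => by rw [hne i j x hj.symm, smul_zero])
          (by simp)]
        simp [h, hself i x h] }
  refine ⟨⟨fun x => L x ≪≫ₗ
    (DirectSum.linearEquivFunOnFintype k ι fun i => PLift (x ∈ S i) → k).symm, fun e y => ?_⟩⟩
  refine DFinsupp.ext fun i => ?_
  refine Eq.trans ?_ (dsum_map_apply (fun i => subsetRep k s t (S i)) e _ i).symm
  funext ⟨h⟩
  have := LinearMap.congr_fun (hmap i e h) y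
  change φ i (t e) (M.map e y) = if h : s e ∈ S i then φ i (s e) y else 0
  split_ifs with hs
  · exact this
  · simpa [hφ i _ hs] using this

/-- A subset representation with vectors and covectors embedding it as a summand has a
complement. -/
theorem exists_complement (M : QRep k s t) (S : Set V) (w : ∀ x, M.space x)
    (φ : ∀ x, M.space x →ₗ[k] k) (hw : ∀ x ∉ S, w x = 0) (hφ : ∀ x ∉ S, φ x = 0)
    (hwe : ∀ e, s e ∈ S → M.map e (w (s e)) = w (t e))
    (hφe : ∀ e, t e ∈ S → φ (t e) ∘ₗ M.map e = φ (s e))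
    (hone : ∀ x ∈ S, φ x (w x) = 1) :
    ∃ (M' : QRep k s t) (ι : ∀ x, M'.space x →ₗ[k] M.space x)
      (P : ∀ x, M.space x →ₗ[k] M'.space x),
      (∀ x y, P x (ι x y) = y) ∧ (∀ x y, φ x (ι x y) = 0) ∧ (∀ x, P x (w x) = 0) ∧
      (∀ x y, ι x (P x y) = y - φ x y • w x) ∧
      (∀ e y, P (t e) (M.map e y) = M'.map e (P (s e) y)) ∧
      ∀ x ∈ S, ∀ [FiniteDimensional k (M.space x)],
        Module.finrank k (M'.space x) < Module.finrank k (M.space x) := by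
  have hU : ∀ e, ∀ x ∈ (φ (s e)).ker, M.map e x ∈ (φ (t e)).ker := by
    intro e x hx
    rw [LinearMap.mem_ker] at hx ⊢
    by_cases ht : t e ∈ S
    · rw [← hx, ← hφe e ht, LinearMap.comp_apply]
    · simp [hφ _ ht]
  let P : ∀ x, M.space x →ₗ[k] (φ x).ker := fun x =>
    (LinearMap.id - (φ x).smulRight (w x)).codRestrict _ fun y => by
      by_cases hx : x ∈ S
      · simp [hone x hx]
      · simp [hφ x hx]
  have hP : ∀ x y, (P x y : M.space x) = y - φ x y • w x := fun x y => rfl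
  refine ⟨M.sub (fun x => (φ x).ker) hU, fun x => (φ x).ker.subtype, P, fun x y => ?_,
    fun x y => y.2, fun x => ?_, hP, fun e y => ?_, fun x hx _ => ?_⟩
  · refine Subtype.ext ((hP x _).trans ?_)
    change y.1 - φ x y.1 • w x = y.1
    rw [LinearMap.mem_ker.mp y.2, zero_smul, sub_zero]
  · refine Subtype.ext ((hP x _).trans ?_)
    change w x - φ x (w x) • w x = 0
    by_cases hx : x ∈ S
    · simp [hone x hx]
    · simp [hw x hx]
  · apply Subtype.ext
    change M.map e y - φ _ (M.map e y) • w _ = M.map e (y - φ _ y • w _)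
    rw [map_sub, map_smul]
    congr 1
    by_cases hs : s e ∈ S <;> by_cases ht : t e ∈ S
    · rw [hwe e hs, ← hφe e ht, LinearMap.comp_apply]
    · simp [hwe e hs, hw _ ht]
    · have := LinearMap.congr_fun (hφe e ht) y
      simp only [LinearMap.comp_apply] at this
      simp [this, hφ _ hs]
    · simp [hφ _ ht, hφ _ hs]
  · refine Submodule.finrank_lt (s := (φ x).ker) fun h => ?_
    have h1 := hone x hx
    rw [LinearMap.ker_eq_top.mp h] at h1
    simp at h1

end General

section TypeA

variable {k : Type} [Field k] {n : ℕ} {d : Fin n → Bool}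

/-- A family of vectors supported on `[a, b]` and compatible with all arrows to the right of `a`
whose source is at most `b`. -/
def IsVectorChain (M : QRep k (sA n d) (tA n d)) (a b : Fin (n + 1)) (w : ∀ x, M.space x) : Prop :=
  (∀ x, ¬ (a ≤ x ∧ x ≤ b) → w x = 0) ∧
    ∀ e : Fin n, a ≤ e.castSucc → sA n d e ≤ b → M.map e (w (sA n d e)) = w (tA n d e)

/-- A family of covectors supported on `[a, b]` and compatible with all arrows to the right of `a`
whose target is at most `b`. -/
def IsCovectorChain (M : QRep k (sA n d) (tA n d)) (a b : Fin (n + 1))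
    (φ : ∀ x, M.space x →ₗ[k] k) : Prop :=
  (∀ x, ¬ (a ≤ x ∧ x ≤ b) → φ x = 0) ∧
    ∀ e : Fin n, a ≤ e.castSucc → tA n d e ≤ b → φ (tA n d e) ∘ₗ M.map e = φ (sA n d e)

/-- For some common right end point, vectors of `B` extend to chains of vectors and covectors
vanishing on `A` extend to chains of covectors. -/
def Extends (M : QRep k (sA n d) (tA n d)) (a : Fin (n + 1)) (A B : Submodule k (M.space a)) :
    Prop :=
  ∃ b, a ≤ b ∧ (∀ v ∈ B, ∃ w, M.IsVectorChain a b w ∧ w a = v) ∧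
    ∀ φ : M.space a →ₗ[k] k, A ≤ φ.ker → ∃ ψ, M.IsCovectorChain a b ψ ∧ ψ a = φ

theorem castSucc_le_sA (e : Fin n) : e.castSucc ≤ sA n d e := by
  unfold sA; split_ifs <;> simp [Fin.le_def]

theorem castSucc_le_tA (e : Fin n) : e.castSucc ≤ tA n d e := by
  unfold tA; split_ifs <;> simp [Fin.le_def]

theorem eq_or_succ_le_castSucc {i e : Fin n} (h : i.castSucc ≤ e.castSucc) :
    e = i ∨ i.succ ≤ e.castSucc := by
  simp only [Fin.le_def, Fin.ext_iff, Fin.val_castSucc, Fin.val_succ] at *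
  omega

theorem ne_castSucc_of_succ_le {i : Fin n} {x : Fin (n + 1)} (h : i.succ ≤ x) :
    x ≠ i.castSucc := by
  simp only [ne_eq, Fin.le_def, Fin.ext_iff, Fin.val_castSucc, Fin.val_succ] at *
  omega

theorem IsVectorChain.update {M : QRep k (sA n d) (tA n d)} {i : Fin n} {b : Fin (n + 1)}
    {w : ∀ x, M.space x} (hw : M.IsVectorChain i.succ b w) (hb : i.succ ≤ b)
    (v : M.space i.castSucc)
    (h : M.map i (Function.update w i.castSucc v (sA n d i)) =
      Function.update w i.castSucc v (tA n d i)) :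
    M.IsVectorChain i.castSucc b (Function.update w i.castSucc v) := by
  refine ⟨fun x hx => ?_, fun e he hs => ?_⟩
  · have hxi : x ≠ i.castSucc := by
      rintro rfl
      exact hx ⟨le_rfl, (Fin.castSucc_lt_succ).le.trans hb⟩
    rw [Function.update_of_ne hxi]
    exact hw.1 x fun h => hx ⟨(Fin.castSucc_lt_succ).le.trans h.1, h.2⟩
  · obtain rfl | he := eq_or_succ_le_castSucc he
    · exact h
    · rw [Function.update_of_ne (ne_castSucc_of_succ_le (he.trans (castSucc_le_sA e))),
        Function.update_of_ne (ne_castSucc_of_succ_le (he.trans (castSucc_le_tA e)))]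
      exact hw.2 e he hs

theorem IsCovectorChain.update {M : QRep k (sA n d) (tA n d)} {i : Fin n} {b : Fin (n + 1)}
    {φ : ∀ x, M.space x →ₗ[k] k} (hφ : M.IsCovectorChain i.succ b φ) (hb : i.succ ≤ b)
    (v : M.space i.castSucc →ₗ[k] k)
    (h : Function.update φ i.castSucc v (tA n d i) ∘ₗ M.map i =
      Function.update φ i.castSucc v (sA n d i)) :
    M.IsCovectorChain i.castSucc b (Function.update φ i.castSucc v) := by
  refine ⟨fun x hx => ?_, fun e he hs => ?_⟩
  · have hxi : x ≠ i.castSucc := by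
      rintro rfl
      exact hx ⟨le_rfl, (Fin.castSucc_lt_succ).le.trans hb⟩
    rw [Function.update_of_ne hxi]
    exact hφ.1 x fun h => hx ⟨(Fin.castSucc_lt_succ).le.trans h.1, h.2⟩
  · obtain rfl | he := eq_or_succ_le_castSucc he
    · exact h
    · rw [Function.update_of_ne (ne_castSucc_of_succ_le (he.trans (castSucc_le_sA e))),
        Function.update_of_ne (ne_castSucc_of_succ_le (he.trans (castSucc_le_tA e)))]
      exact hφ.2 e he hs

theorem isVectorChain_single {M : QRep k (sA n d) (tA n d)} {a : Fin (n + 1)} (v : M.space a)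
    (h : ∀ e : Fin n, e.castSucc = a → sA n d e ≤ a →
      M.map e (Function.update (0 : ∀ x, M.space x) a v (sA n d e)) =
        Function.update (0 : ∀ x, M.space x) a v (tA n d e)) :
    M.IsVectorChain a a (Function.update (0 : ∀ x, M.space x) a v) := by
  refine ⟨fun x hx => Function.update_of_ne ?_ _ _, fun e he hs => h e ?_ hs⟩
  · rintro rfl
    exact hx ⟨le_rfl, le_rfl⟩
  · exact le_antisymm ((castSucc_le_sA e).trans hs) he

theorem isCovectorChain_single {M : QRep k (sA n d) (tA n d)} {a : Fin (n + 1)}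
    (φ : M.space a →ₗ[k] k)
    (h : ∀ e : Fin n, e.castSucc = a → tA n d e ≤ a →
      Function.update (0 : ∀ x, M.space x →ₗ[k] k) a φ (tA n d e) ∘ₗ M.map e =
        Function.update (0 : ∀ x, M.space x →ₗ[k] k) a φ (sA n d e)) :
    M.IsCovectorChain a a (Function.update (0 : ∀ x, M.space x →ₗ[k] k) a φ) := by
  refine ⟨fun x hx => Function.update_of_ne ?_ _ _, fun e he hs => h e ?_ hs⟩
  · rintro rfl
    exact hx ⟨le_rfl, le_rfl⟩
  · exact le_antisymm ((castSucc_le_tA e).trans hs) he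

theorem exists_comp_eq_of_comap_le_ker {X Y : Type} [AddCommGroup X] [Module k X]
    [AddCommGroup Y] [Module k Y] (f : X →ₗ[k] Y) (A : Submodule k Y) (φ : X →ₗ[k] k)
    (h : A.comap f ≤ φ.ker) : ∃ ψ : Y →ₗ[k] k, A ≤ ψ.ker ∧ ψ ∘ₗ f = φ := by
  have hker : (A.mkQ ∘ₗ f).ker ≤ φ.ker := by
    rwa [LinearMap.ker_comp, Submodule.ker_mkQ]
  have hφ : φ ∈ (A.mkQ ∘ₗ f).dualMap.range := by
    rw [LinearMap.range_dualMap_eq_dualAnnihilator_ker, Submodule.mem_dualAnnihilator]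
    exact fun x hx => hker hx
  obtain ⟨χ, rfl⟩ := hφ
  refine ⟨χ ∘ₗ A.mkQ, fun x hx => ?_, rfl⟩
  simp [(Submodule.Quotient.mk_eq_zero A).mpr hx]

theorem reflTransGen_extends (M : QRep k (sA n d) (tA n d)) (a : Fin (n + 1)) :
    Relation.ReflTransGen (M.Extends a) ⊥ ⊤ := by
  induction a using Fin.reverseInduction with
  | last =>
    refine .single ⟨Fin.last n, le_rfl, fun v _ => ⟨_, isVectorChain_single v ?_, by simp⟩,
      fun φ _ => ⟨_, isCovectorChain_single φ ?_, by simp⟩⟩ <;>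
    exact fun e he => absurd he (Fin.castSucc_ne_last e)
  | cast i ih =>
    have hne : i.succ ≠ i.castSucc := (Fin.castSucc_lt_succ).ne'
    cases hd : d i with
    | true =>
      have hs : sA n d i = i.castSucc := by simp [sA, hd]
      have ht : tA n d i = i.succ := by simp [tA, hd]
      obtain ⟨f, hfw, hfφ⟩ := M.exists_map_of_eq i hs ht
      refine .head (b := (⊥ : Submodule k (M.space i.succ)).comap f) ?_
        (Relation.ReflTransGen.lift (Submodule.comap f) ?_ _ _ ih)
      · refine ⟨i.castSucc, le_rfl, fun v hv => ⟨_, isVectorChain_single v ?_, by simp⟩,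
          fun φ _ => ⟨_, isCovectorChain_single φ ?_, by simp⟩⟩
        · intro e he _
          obtain rfl := Fin.castSucc_injective n he
          rw [hfw]
          simpa [Function.update_of_ne hne] using hv
        · intro e he hle
          obtain rfl := Fin.castSucc_injective n he
          rw [ht] at hle
          exact absurd hle (Fin.castSucc_lt_succ).not_ge
      · rintro A B ⟨b, hb, hB, hA⟩
        refine ⟨b, (Fin.castSucc_lt_succ).le.trans hb, fun v hv => ?_, fun φ hφ => ?_⟩
        · obtain ⟨w, hw, hwv⟩ := hB (f v) hv
          refine ⟨_, hw.update hb v ?_, by simp⟩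
          rw [hfw]
          simp [Function.update_of_ne hne, hwv]
        · obtain ⟨χ, hAχ, hχ⟩ := exists_comp_eq_of_comap_le_ker f A φ hφ
          obtain ⟨ψ, hψ, hψχ⟩ := hA χ hAχ
          refine ⟨_, hψ.update hb φ ?_, by simp⟩
          rw [hfφ]
          simp [Function.update_of_ne hne, hψχ, hχ]
    | false =>
      have hs : sA n d i = i.succ := by simp [sA, hd]
      have ht : tA n d i = i.castSucc := by simp [tA, hd]
      obtain ⟨f, hfw, hfφ⟩ := M.exists_map_of_eq i hs ht
      refine .tail (b := (⊤ : Submodule k (M.space i.succ)).map f) ?_ ?_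
      · have := Relation.ReflTransGen.lift (p := M.Extends i.castSucc) (Submodule.map f) ?_ _ _ ih
        · simpa only [Function.onFun, Submodule.map_bot] using this
        rintro A B ⟨b, hb, hB, hA⟩
        refine ⟨b, (Fin.castSucc_lt_succ).le.trans hb, fun v hv => ?_, fun φ hφ => ?_⟩
        · obtain ⟨u, hu, rfl⟩ := hv
          obtain ⟨w, hw, hwu⟩ := hB u hu
          refine ⟨_, hw.update hb (f u) ?_, by simp⟩
          rw [hfw]
          simp [Function.update_of_ne hne, hwu]
        · obtain ⟨ψ, hψ, hψφ⟩ := hA (φ ∘ₗ f) fun x hx =>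
            hφ (Submodule.mem_map_of_mem hx)
          refine ⟨_, hψ.update hb φ ?_, by simp⟩
          rw [hfφ]
          simp [Function.update_of_ne hne, hψφ]
      · refine ⟨i.castSucc, le_rfl, fun v hv => ⟨_, isVectorChain_single v ?_, by simp⟩,
          fun φ hφ => ⟨_, isCovectorChain_single φ ?_, by simp⟩⟩
        · intro e he hle
          obtain rfl := Fin.castSucc_injective n he
          rw [hs] at hle
          exact absurd hle (Fin.castSucc_lt_succ).not_ge
        · intro e he _
          obtain rfl := Fin.castSucc_injective n he
          rw [hfφ]
          simp only [Function.update_self, Function.update_of_ne hne]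
          exact LinearMap.ext fun x => hφ (Submodule.mem_map_of_mem (Submodule.mem_top (x := x)))

/-- A representation of type `A` which is nonzero at some vertex has an interval summand. -/
theorem exists_interval_summand (M : QRep k (sA n d) (tA n d))
    (hM : ∃ a, Nontrivial (M.space a)) :
    ∃ (a b : Fin (n + 1)) (w : ∀ x, M.space x) (φ : ∀ x, M.space x →ₗ[k] k), a ≤ b ∧
      (∀ x, ¬ (a ≤ x ∧ x ≤ b) → w x = 0) ∧ (∀ x, ¬ (a ≤ x ∧ x ≤ b) → φ x = 0) ∧
      (∀ e, (a ≤ sA n d e ∧ sA n d e ≤ b) → M.map e (w (sA n d e)) = w (tA n d e)) ∧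
      (∀ e, (a ≤ tA n d e ∧ tA n d e ≤ b) → φ (tA n d e) ∘ₗ M.map e = φ (sA n d e)) ∧
      ∀ x, (a ≤ x ∧ x ≤ b) → φ x (w x) = 1 := by
  obtain ⟨a, ha, hmin⟩ := WellFounded.has_min (wellFounded_lt (α := Fin (n + 1)))
    {a | Nontrivial (M.space a)} hM
  have hsub : ∀ x < a, Subsingleton (M.space x) := fun x hx =>
    not_nontrivial_iff_subsingleton.mp fun h => hmin x h hx
  obtain ⟨A, B, ⟨b, hab, hB, hA⟩, hBA⟩ : ∃ A B, M.Extends a A B ∧ ¬ B ≤ A := by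
    by_contra! hcon
    have key : ∀ C, Relation.ReflTransGen (M.Extends a) ⊥ C → C ≤ ⊥ := by
      intro C hC
      induction hC with
      | refl => exact le_rfl
      | tail _ h ih => exact (hcon _ _ h).trans ih
    have ha' : Nontrivial (M.space a) := ha
    exact top_ne_bot (le_bot_iff.mp (key _ (M.reflTransGen_extends a)))
  obtain ⟨v, hvB, hvA⟩ := SetLike.not_le_iff_exists.mp hBA
  obtain ⟨φ₀, hφv, hφA⟩ : ∃ φ₀ : M.space a →ₗ[k] k, φ₀ v = 1 ∧ A ≤ φ₀.ker := by
    obtain ⟨f, hf, hfA⟩ := Submodule.exists_le_ker_of_notMem hvA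
    refine ⟨(f v)⁻¹ • f, by simp [hf], fun x hx => ?_⟩
    simp [LinearMap.mem_ker.mp (hfA hx)]
  obtain ⟨w, hw, rfl⟩ := hB v hvB
  obtain ⟨φ, hφ, rfl⟩ := hA φ₀ hφA
  have hwe : ∀ e, (a ≤ sA n d e ∧ sA n d e ≤ b) → M.map e (w (sA n d e)) = w (tA n d e) := by
    intro e he
    rcases le_or_gt a e.castSucc with h | h
    · exact hw.2 e h he.2
    · have : Subsingleton (M.space (tA n d e)) := by
        cases hd : d e with
        | true => exact absurd he.1 (by simpa [sA, hd] using h)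
        | false => exact hsub _ (by simpa [tA, hd] using h)
      exact Subsingleton.elim _ _
  have hφe : ∀ e, (a ≤ tA n d e ∧ tA n d e ≤ b) →
      φ (tA n d e) ∘ₗ M.map e = φ (sA n d e) := by
    intro e he
    rcases le_or_gt a e.castSucc with h | h
    · exact hφ.2 e h he.2
    · have : Subsingleton (M.space (sA n d e)) := by
        cases hd : d e with
        | true => exact hsub _ (by simpa [sA, hd] using h)
        | false => exact absurd he.1 (by simpa [tA, hd] using h)
      exact Subsingleton.elim _ _
  refine ⟨a, b, w, φ, hab, hw.1, hφ.1, hwe, hφe, fun x => ?_⟩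
  induction x using Fin.induction with
  | zero =>
    intro h
    obtain rfl : a = 0 := le_antisymm h.1 (Fin.zero_le a)
    exact hφv
  | succ i ih =>
    intro h
    rcases h.1.eq_or_lt with rfl | hlt
    · exact hφv
    have hi : a ≤ i.castSucc ∧ i.castSucc ≤ b :=
      ⟨Fin.le_castSucc_iff.mpr hlt, (Fin.castSucc_lt_succ).le.trans h.2⟩
    have hmem : (a ≤ sA n d i ∧ sA n d i ≤ b) ∧ (a ≤ tA n d i ∧ tA n d i ≤ b) := by
      unfold sA tA
      split_ifs
      exacts [⟨hi, h⟩, ⟨h, hi⟩]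
    have heq : φ (tA n d i) (w (tA n d i)) = φ (sA n d i) (w (sA n d i)) := by
      rw [← hwe i hmem.1, ← hφe i hmem.2, LinearMap.comp_apply]
    cases hd : d i with
    | true =>
      have hs : sA n d i = i.castSucc := by simp [sA, hd]
      have ht : tA n d i = i.succ := by simp [tA, hd]
      rw [hs, ht, ih hi] at heq
      exact heq
    | false =>
      have hs : sA n d i = i.succ := by simp [sA, hd]
      have ht : tA n d i = i.castSucc := by simp [tA, hd]
      rw [hs, ht, ih hi] at heq
      exact heq.symm

/-- A dual system of vectors and covectors exhibiting a finite-dimensional representation of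
type `A` as a direct sum of interval representations. -/
theorem exists_interval_system (m : ℕ) (M : QRep k (sA n d) (tA n d)) (hM : M.FinDim)
    (hm : ∑ x, Module.finrank k (M.space x) ≤ m) :
    ∃ (N : ℕ) (F : Fin N → Fin (n + 1) × Fin (n + 1)) (w : Fin N → ∀ x, M.space x)
      (φ : Fin N → ∀ x, M.space x →ₗ[k] k),
      (∀ i, (F i).1 ≤ (F i).2) ∧
      (∀ i x, ¬ ((F i).1 ≤ x ∧ x ≤ (F i).2) → φ i x = 0) ∧
      (∀ i e, ((F i).1 ≤ tA n d e ∧ tA n d e ≤ (F i).2) →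
        φ i (tA n d e) ∘ₗ M.map e = φ i (sA n d e)) ∧
      (∀ i x, ((F i).1 ≤ x ∧ x ≤ (F i).2) → φ i x (w i x) = 1) ∧
      (∀ i j x, i ≠ j → φ i x (w j x) = 0) ∧
      ∀ x y, ∑ i, φ i x y • w i x = y := by
  induction m generalizing M with
  | zero =>
    have hsub : ∀ x, Subsingleton (M.space x) := fun x => by
      have := hM x
      have h := (Finset.sum_eq_zero_iff.mp (Nat.le_zero.mp hm)) x (Finset.mem_univ x)
      exact Module.finrank_zero_iff.mp h
    exact ⟨0, Fin.elim0, fun i => i.elim0, fun i => i.elim0, fun i => i.elim0, fun i => i.elim0,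
      fun i => i.elim0, fun i => i.elim0, fun i => i.elim0,
      fun x y => (hsub x).elim _ _⟩
  | succ m ih =>
    by_cases hne : ∃ a, Nontrivial (M.space a)
    swap
    · have hsub : ∀ x, Subsingleton (M.space x) := fun x =>
        not_nontrivial_iff_subsingleton.mp fun h => hne ⟨x, h⟩
      refine ih M hM ?_
      rw [Finset.sum_eq_zero fun x _ => Module.finrank_zero_of_subsingleton]
      exact Nat.zero_le m
    obtain ⟨a, b, w₀, φ₀, hab, hw₀, hφ₀, hwe, hφe, hone⟩ := M.exists_interval_summand hne
    obtain ⟨M', ι, P, hPι, hφι, hPw, hιP, hPmap, hlt⟩ :=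
      M.exists_complement {x | a ≤ x ∧ x ≤ b} w₀ φ₀ hw₀ hφ₀ hwe hφe hone
    have hinj : ∀ x, Function.Injective (ι x) := fun x => Function.LeftInverse.injective (hPι x)
    have hfin : M'.FinDim := fun x => by
      have := hM x
      exact FiniteDimensional.of_injective (ι x) (hinj x)
    have hsum : ∑ x, Module.finrank k (M'.space x) < ∑ x, Module.finrank k (M.space x) := by
      refine Finset.sum_lt_sum (fun x _ => ?_) ⟨a, Finset.mem_univ a, ?_⟩
      · have := hM x
        exact LinearMap.finrank_le_finrank_of_injective (hinj x)
      · have := hM a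
        exact hlt a ⟨le_rfl, hab⟩
    obtain ⟨N, F, w, φ, hF, hφ0, hφm, hφ1, hφne, hφs⟩ := ih M' hfin (by omega)
    refine ⟨N + 1, Fin.cons (a, b) F, Fin.cons w₀ fun i x => ι x (w i x),
      Fin.cons φ₀ fun i x => φ i x ∘ₗ P x, ?_, ?_, ?_, ?_, ?_, ?_⟩
    · exact Fin.cases hab hF
    · refine Fin.cases hφ₀ fun i x hx => ?_
      simp only [Fin.cons_succ] at hx ⊢
      rw [hφ0 i x hx, LinearMap.zero_comp]
    · refine Fin.cases hφe fun i e he => LinearMap.ext fun y => ?_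
      simp only [Fin.cons_succ, LinearMap.comp_apply] at he ⊢
      rw [hPmap, ← hφm i e he, LinearMap.comp_apply]
    · refine Fin.cases hone fun i x hx => ?_
      simp only [Fin.cons_succ, LinearMap.comp_apply] at hx ⊢
      rw [hPι, hφ1 i x hx]
    · refine Fin.cases (Fin.cases (fun x h => absurd rfl h) fun j x _ => hφι x _)
        fun i => Fin.cases (fun x _ => ?_) fun j x hij => ?_
      · simp [hPw]
      · simpa [hPι] using hφne i j x fun h => hij (by rw [h])
    · intro x y
      have h := congrArg (ι x) (hφs x (P x y))
      simp only [map_sum, map_smul, hιP] at h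
      simp [Fin.sum_univ_succ, h]

end TypeA

end QRep

/-- Every finite-dimensional representation of a quiver of type `A_{n+1}`
(any orientation `d`) is isomorphic to a direct sum of interval (thin indecomposable)
representations `M([s,t])`. -/
theorem stmt4 (k : Type) [Field k] (n : ℕ) (d : Fin n → Bool)
    (M : QRep k (sA n d) (tA n d)) (hM : M.FinDim) :
    ∃ (N : ℕ) (F : Fin N → Fin (n + 1) × Fin (n + 1)),
      (∀ i, (F i).1 ≤ (F i).2) ∧
      Nonempty (QRep.Iso M (QRep.dsum fun i =>
        subsetRep k (sA n d) (tA n d) {x | (F i).1 ≤ x ∧ x ≤ (F i).2})) := by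
  obtain ⟨N, F, w, φ, hF, hφ0, hφm, hφ1, hφne, hφs⟩ := QRep.exists_interval_system _ M hM le_rfl
  exact ⟨N, F, hF, M.nonempty_iso_dsum_subsetRep _ w φ hφ0 hφm hφ1 hφne hφs⟩
end

section
/- Let Q(n) (n ≥ 4) be the quiver with vertices 1,...,n, arrows π_1: 3 → 1, π_2: 3 → 2, and arrows i+1 → i for 3 ≤ i ≤ n−1. Let B̌ denote the full subcategory of representations M for which the combined map (π_1, π_2): M_3 → M_1 ⊕ M_2 is bijective. Then every representation of Q(n) (not necessarily finite-dimensional) is the direct sum of a representation in B̌ and a direct sum of thin representations. -/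
/-! A framework for representations of the quiver `Q(n)` of type `D_n` (`n = m + 3`):
vertices `1, 2` (two tips, here `T1`, `T2`), and an arm `3, 4, ..., n` (here `A 0, ..., A m`),
with arrows `π₁ : 3 → 1`, `π₂ : 3 → 2` (here `p1`, `p2`) and `i+1 → i` for `3 ≤ i < n`
(here `f i : A i.succ →ₗ A i.castSucc`). -/

structure DRep (k : Type) [Field k] (m : ℕ) where
  T1 : Type
  T2 : Type
  A : Fin (m + 1) → Type
  [acg1 : AddCommGroup T1]
  [mod1 : Module k T1]
  [acg2 : AddCommGroup T2]
  [mod2 : Module k T2]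
  [acgA : ∀ i, AddCommGroup (A i)]
  [modA : ∀ i, Module k (A i)]
  p1 : A ⟨0, Nat.succ_pos m⟩ →ₗ[k] T1
  p2 : A ⟨0, Nat.succ_pos m⟩ →ₗ[k] T2
  f : ∀ i : Fin m, A i.succ →ₗ[k] A i.castSucc

attribute [instance] DRep.acg1 DRep.mod1 DRep.acg2 DRep.mod2 DRep.acgA DRep.modA

namespace DRep

variable {k : Type} [Field k] {m : ℕ}

/-- A morphism of representations of `Q(m+3)`. -/
structure Hom (M N : DRep k m) where
  g1 : M.T1 →ₗ[k] N.T1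
  g2 : M.T2 →ₗ[k] N.T2
  gA : ∀ i, M.A i →ₗ[k] N.A i
  comm1 : ∀ x, g1 (M.p1 x) = N.p1 (gA ⟨0, Nat.succ_pos m⟩ x)
  comm2 : ∀ x, g2 (M.p2 x) = N.p2 (gA ⟨0, Nat.succ_pos m⟩ x)
  commf : ∀ (i : Fin m) x, gA i.castSucc (M.f i x) = N.f i (gA i.succ x)

/-- An isomorphism of representations of `Q(m+3)`. -/
structure Iso (M N : DRep k m) where
  g1 : M.T1 ≃ₗ[k] N.T1
  g2 : M.T2 ≃ₗ[k] N.T2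
  gA : ∀ i, M.A i ≃ₗ[k] N.A i
  comm1 : ∀ x, g1 (M.p1 x) = N.p1 (gA ⟨0, Nat.succ_pos m⟩ x)
  comm2 : ∀ x, g2 (M.p2 x) = N.p2 (gA ⟨0, Nat.succ_pos m⟩ x)
  commf : ∀ (i : Fin m) x, gA i.castSucc (M.f i x) = N.f i (gA i.succ x)

/-- The identity morphism. -/
def Hom.id (M : DRep k m) : Hom M M :=
  ⟨LinearMap.id, LinearMap.id, fun _ => LinearMap.id,
    fun _ => rfl, fun _ => rfl, fun _ _ => rfl⟩

/-- Composition of morphisms. -/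
def Hom.comp {M N P : DRep k m} (ψ : Hom N P) (φ : Hom M N) : Hom M P where
  g1 := ψ.g1.comp φ.g1
  g2 := ψ.g2.comp φ.g2
  gA i := (ψ.gA i).comp (φ.gA i)
  comm1 x := by simp only [LinearMap.comp_apply]; rw [φ.comm1, ψ.comm1]
  comm2 x := by simp only [LinearMap.comp_apply]; rw [φ.comm2, ψ.comm2]
  commf i x := by simp only [LinearMap.comp_apply]; rw [φ.commf, ψ.commf]

/-- The (binary) direct sum of two representations. -/
def prod (M N : DRep k m) : DRep k m where
  T1 := M.T1 × N.T1
  T2 := M.T2 × N.T2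
  A i := M.A i × N.A i
  acgA i := inferInstanceAs (AddCommGroup (M.A i × N.A i))
  modA i := inferInstanceAs (Module k (M.A i × N.A i))
  p1 := M.p1.prodMap N.p1
  p2 := M.p2.prodMap N.p2
  f i := (M.f i).prodMap (N.f i)

/-- The direct sum of an arbitrary family of representations. -/
noncomputable def dsum {ι : Type} (F : ι → DRep k m) : DRep k m :=
  letI := Classical.decEq ι
  { T1 := DirectSum ι fun i => (F i).T1
    T2 := DirectSum ι fun i => (F i).T2
    A := fun v => DirectSum ι fun i => (F i).A v
    acgA := fun v => inferInstanceAs (AddCommGroup (DirectSum ι fun i => (F i).A v))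
    modA := fun v => inferInstanceAs (Module k (DirectSum ι fun i => (F i).A v))
    p1 := DirectSum.toModule k ι (DirectSum ι fun i => (F i).T1)
      fun i => (DirectSum.lof k ι (fun j => (F j).T1) i).comp ((F i).p1)
    p2 := DirectSum.toModule k ι (DirectSum ι fun i => (F i).T2)
      fun i => (DirectSum.lof k ι (fun j => (F j).T2) i).comp ((F i).p2)
    f := fun v => DirectSum.toModule k ι (DirectSum ι fun i => (F i).A v.castSucc)
      fun i => (DirectSum.lof k ι (fun j => (F j).A v.castSucc) i).comp ((F i).f v) }

/-- The zero representation predicate. -/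
def IsZero (M : DRep k m) : Prop :=
  (∀ x : M.T1, x = 0) ∧ (∀ x : M.T2, x = 0) ∧ ∀ i, ∀ x : M.A i, x = 0

/-- Indecomposability: nonzero, and any direct sum decomposition has a zero summand. -/
def Indecomposable (M : DRep k m) : Prop :=
  ¬ M.IsZero ∧ ∀ N₁ N₂ : DRep k m, Nonempty (Iso M (N₁.prod N₂)) → N₁.IsZero ∨ N₂.IsZero

/-- Thin: all vertex spaces of dimension at most `1`. -/
def Thin (M : DRep k m) : Prop :=
  Module.rank k M.T1 ≤ 1 ∧ Module.rank k M.T2 ≤ 1 ∧ ∀ i, Module.rank k (M.A i) ≤ 1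

/-- All vertex spaces finite-dimensional. -/
def FinDim (M : DRep k m) : Prop :=
  FiniteDimensional k M.T1 ∧ FiniteDimensional k M.T2 ∧ ∀ i, FiniteDimensional k (M.A i)

/-- Membership in the subcategory `B̌`: the combined map
`(π₁, π₂) : M₃ → M₁ ⊕ M₂` is bijective. -/
def InB (M : DRep k m) : Prop :=
  Function.Bijective (fun x : M.A ⟨0, Nat.succ_pos m⟩ => (M.p1 x, M.p2 x))

end DRep

section LinearAlgebra

open Submodule

variable {k : Type} [Field k] {ι X Y : Type} [AddCommGroup X] [Module k X]
  [AddCommGroup Y] [Module k Y]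

/-- The nonzero members of the family `e` map to a basis of the quotient by `N`. -/
def IsBasisMod (N : Submodule k X) (e : ι → X) : Prop :=
  LinearIndepOn k (N.mkQ ∘ e) {i | e i ≠ 0} ∧ N ⊔ span k (Set.range e) = ⊤

theorem span_image_inter_ne_zero (e : ι → X) (s : Set ι) :
    span k (e '' (s ∩ {i | e i ≠ 0})) = span k (e '' s) := by
  refine le_antisymm (span_mono (Set.image_mono Set.inter_subset_left)) (span_le.2 ?_)
  rintro _ ⟨i, hi, rfl⟩
  by_cases h : e i = 0
  · rw [h]; exact zero_mem _
  · exact subset_span ⟨i, ⟨hi, h⟩, rfl⟩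

theorem disjoint_span_image_of_ne_zero {e : ι → X} (he : LinearIndepOn k e {i | e i ≠ 0})
    {s t : Set ι} (hst : Disjoint s t) : Disjoint (span k (e '' s)) (span k (e '' t)) := by
  rw [← span_image_inter_ne_zero e s, ← span_image_inter_ne_zero e t]
  exact ((linearIndepOn_union_iff (hst.mono Set.inter_subset_left Set.inter_subset_left)).1
    (he.mono (Set.union_subset Set.inter_subset_right Set.inter_subset_right))).2.2

/-- A linearly independent set which is adapted to a finite flag extends to an adapted basis. -/
theorem exists_adapted_extension (F : ℕ → Submodule k X) (hF : Monotone F) {S : Set X}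
    (hS : LinearIndepOn k id S) (hSF : ∀ j, span k S ⊓ F j ≤ span k (S ∩ F j)) (N : ℕ) :
    ∃ B : Set X, S ∩ F N ⊆ B ∧ B ⊆ F N ∧ LinearIndepOn k id B ∧
      ∀ j ≤ N, F j ≤ span k (B ∩ F j) := by
  induction N with
  | zero =>
    obtain ⟨B, hBF, hSB, hFB, hB⟩ := exists_linearIndepOn_id_extension
      (hS.mono (Set.inter_subset_left (t := (F 0 : Set X)))) Set.inter_subset_right
    refine ⟨B, hSB, hBF, hB, fun j hj => ?_⟩
    obtain rfl := Nat.le_zero.1 hj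
    rwa [Set.inter_eq_left.2 hBF]
  | succ N ih =>
    obtain ⟨B, hSB, hBF, hB, hFB⟩ := ih
    have hspan : span k B = F N := le_antisymm (span_le.2 hBF)
      ((hFB N le_rfl).trans (span_mono Set.inter_subset_left))
    have hdisj : Disjoint (span k B) (span k ((S ∩ F (N + 1)) \ F N)) := by
      have hS' : Disjoint (span k (S ∩ F N)) (span k ((S ∩ F (N + 1)) \ F N)) := by
        refine ((linearIndepOn_id_union_iff ?_).1 (hS.mono ?_)).2.2
        · exact Set.disjoint_left.2 fun x hx hx' => hx'.2 hx.2
        · exact Set.union_subset Set.inter_subset_left fun x hx => hx.1.1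
      rw [hspan, disjoint_def]
      intro x hx hx'
      refine disjoint_def.1 hS' x (hSF N ⟨span_mono (fun y hy => hy.1.1) hx', hx⟩) hx'
    have hU := hB.id_union (hS.mono fun x hx => hx.1.1) hdisj
    obtain ⟨B', hBF', hSB', hFB', hB'⟩ := exists_linearIndepOn_id_extension hU
      (t := (F (N + 1) : Set X)) (Set.union_subset
        (hBF.trans (hF N.le_succ)) fun x hx => hx.1.2)
    refine ⟨B', ?_, hBF', hB', fun j hj => ?_⟩
    · intro x hx
      by_cases h : x ∈ F N
      · exact hSB' (Or.inl (hSB ⟨hx.1, h⟩))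
      · exact hSB' (Or.inr ⟨hx, h⟩)
    · rcases Nat.le_succ_iff.1 hj with h | rfl
      · exact (hFB j h).trans (span_mono (Set.inter_subset_inter_left _
          (Set.subset_union_left.trans hSB')))
      · rwa [Set.inter_eq_left.2 hBF']

/-- Family version of `exists_adapted_extension`. -/
theorem exists_adapted_family_extension (F : ℕ → Submodule k X) (hF : Monotone F) {N : ℕ}
    (hN : F N = ⊤) {e : ι → X} (he : LinearIndepOn k e {i | e i ≠ 0})
    (heF : ∀ j, span k (Set.range e) ⊓ F j ≤ span k (e '' {i | e i ∈ F j})) :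
    ∃ d : X → X, LinearIndepOn k (Sum.elim e d) {i | Sum.elim e d i ≠ 0} ∧
      ∀ j, F j ≤ span k (Sum.elim e d '' {i | Sum.elim e d i ∈ F j}) := by
  classical
  set S : Set X := e '' {i | e i ≠ 0} with hSdef
  have hspanS : span k S = span k (Set.range e) := by
    have := span_image_inter_ne_zero (k := k) e Set.univ
    rwa [Set.univ_inter, Set.image_univ] at this
  obtain ⟨B, hSB, -, hB, hFB⟩ := exists_adapted_extension F hF he.id_image (fun j => by
    rw [← hSdef, hspanS]
    refine (heF j).trans ?_
    rw [← span_image_inter_ne_zero]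
    refine span_mono ?_
    rintro _ ⟨i, ⟨hi, h0⟩, rfl⟩
    exact ⟨⟨i, h0, rfl⟩, hi⟩) N
  have hSB : S ⊆ B := fun x hx => hSB ⟨hx, by rw [hN]; trivial⟩
  refine ⟨fun x => if x ∈ B \ S then x else 0, ?_, fun j => ?_⟩
  · rw [linearIndepOn_iff_image]
    · refine hB.mono ?_
      rintro _ ⟨i | x, hi, rfl⟩
      · exact hSB ⟨i, hi, rfl⟩
      · simp only [Set.mem_ofPred_eq, Sum.elim_inr, ne_eq, ite_eq_right_iff, not_forall] at hi ⊢
        obtain ⟨hx, -⟩ := hi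
        rw [if_pos hx]; exact hx.1
    · rintro (i | x) hi (j | y) hj hij
      · exact congrArg _ (he.injOn hi hj hij)
      · simp only [Set.mem_ofPred_eq, Sum.elim_inr, ne_eq, ite_eq_right_iff, not_forall] at hj
        simp only [Sum.elim_inl, Sum.elim_inr, if_pos hj.1] at hij
        exact absurd ⟨i, hi, hij⟩ hj.1.2
      · simp only [Set.mem_ofPred_eq, Sum.elim_inr, ne_eq, ite_eq_right_iff, not_forall] at hi
        simp only [Sum.elim_inl, Sum.elim_inr, if_pos hi.1] at hij
        exact absurd ⟨j, hj, hij.symm⟩ hi.1.2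
      · simp only [Set.mem_ofPred_eq, Sum.elim_inr, ne_eq, ite_eq_right_iff, not_forall] at hi hj
        simp only [Sum.elim_inr, if_pos hi.1, if_pos hj.1] at hij
        rw [hij]
  · have hj : F j ≤ span k (B ∩ F j) := by
      rcases le_total j N with h | h
      · exact hFB j h
      · have htop : F j = F N := le_antisymm (hN ▸ le_top) (hF h)
        rw [htop]; exact hFB N le_rfl
    refine hj.trans (span_mono ?_)
    rintro x ⟨hxB, hxF⟩
    by_cases hx : x ∈ S
    · obtain ⟨i, -, rfl⟩ := hx
      exact ⟨Sum.inl i, hxF, rfl⟩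
    · have h : Sum.elim e (fun x => if x ∈ B \ S then x else 0) (Sum.inr x) = x :=
        if_pos ⟨hxB, hx⟩
      exact ⟨Sum.inr x, by rw [Set.mem_ofPred_eq, h]; exact hxF, h⟩

/-- A chain of vector spaces decomposes into intervals, compatibly with a finite flag on its
last term. -/
theorem exists_chain_basis (m : ℕ) (A : Fin (m + 1) → Type) [∀ i, AddCommGroup (A i)]
    [∀ i, Module k (A i)] (f : ∀ i : Fin m, A i.succ →ₗ[k] A i.castSucc)
    (F : ℕ → Submodule k (A 0)) (hF : Monotone F) (N : ℕ) (hN : F N = ⊤) :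
    ∃ (ι : Type) (e : ∀ j, ι → A j), (∀ j, LinearIndepOn k (e j) {i | e j i ≠ 0}) ∧
      (∀ j, span k (Set.range (e j)) = ⊤) ∧
      (∀ j i, f j (e j.succ i) ∈ span k {e j.castSucc i}) ∧
      ∀ j, F j ≤ span k (e 0 '' {i | e 0 i ∈ F j}) := by
  induction m generalizing N with
  | zero =>
    have he : LinearIndepOn k (Empty.elim : Empty → A 0) {i | Empty.elim i ≠ (0 : A 0)} :=
      linearIndependent_empty_type
    obtain ⟨d, hd, hdF⟩ := exists_adapted_family_extension F hF hN he
      (fun j => by rw [Set.range_eq_empty, span_empty, bot_inf_eq]; exact bot_le)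
    let e : ∀ j : Fin 1, Empty ⊕ A 0 → A j :=
      Fin.cases (motive := fun j => Empty ⊕ A 0 → A j) (Sum.elim Empty.elim d) fun j => j.elim0
    refine ⟨Empty ⊕ A 0, e, fun j => ?_, fun j => ?_, fun j => j.elim0, hdF⟩
    · obtain rfl : (0 : Fin 1) = j := Subsingleton.elim _ _
      exact hd
    · obtain rfl : (0 : Fin 1) = j := Subsingleton.elim _ _
      exact top_le_iff.1 (hN ▸ (hdF N).trans (span_mono (Set.image_subset_range _ _)))
  | succ m ih =>
    let f₀ : A (Fin.succ 0) →ₗ[k] A 0 := f 0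
    let F' : ℕ → Submodule k (A (Fin.succ 0)) := fun j =>
      Nat.casesOn j (LinearMap.ker f₀) fun j => (F j).comap f₀
    have hF' : Monotone F' := monotone_nat_of_le_succ fun j => by
      cases j with
      | zero => exact LinearMap.ker_le_comap _
      | succ j => exact comap_mono (hF j.le_succ)
    obtain ⟨ι, e, he, hspan, hfe, hadapt⟩ := ih (fun j => A j.succ)
      (fun j => f j.succ) F' hF' (N + 1) (by change (F N).comap f₀ = ⊤; rw [hN, comap_top])
    have hker : LinearMap.ker f₀ ≤ span k (e 0 '' {i | f₀ (e 0 i) = 0}) := hadapt 0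
    have hind : LinearIndepOn k (f₀ ∘ e 0) {i | (f₀ ∘ e 0) i ≠ 0} := by
      refine LinearIndependent.map (v := fun i : {i | (f₀ ∘ e 0) i ≠ 0} => e 0 i)
        ((he 0).mono fun i hi h0 => hi ((congrArg f₀ h0).trans (map_zero f₀))) ?_
      · refine Disjoint.mono_right hker ?_
        rw [← Set.image_eq_range]
        exact disjoint_span_image_of_ne_zero (he 0) (Set.disjoint_left.2 fun i hi hi' => hi hi')
    obtain ⟨d, hd, hdF⟩ := exists_adapted_family_extension F hF hN hind (fun j => by
      rintro x ⟨hx, hxF⟩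
      rw [Set.range_comp, span_image] at hx
      obtain ⟨y, -, rfl⟩ := hx
      have hy : y ∈ span k (e 0 '' {i | f₀ (e 0 i) ∈ F j}) := hadapt (j + 1) hxF
      have := mem_map_of_mem (f := f₀) hy
      rwa [map_span, Set.image_image] at this)
    let e' : ∀ j : Fin (m + 2), ι ⊕ A 0 → A j :=
      Fin.cases (motive := fun j => ι ⊕ A 0 → A j) (Sum.elim (f₀ ∘ e 0) d)
        fun j => Sum.elim (e j) 0
    refine ⟨ι ⊕ A 0, e', fun j => ?_, fun j => ?_, fun j => ?_, hdF⟩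
    · cases j using Fin.cases with
      | zero => exact hd
      | succ j =>
        have hset : {i | e' j.succ i ≠ 0} = Sum.inl '' {i | e j i ≠ 0} := by
          ext (i | i) <;> simp [e']
        rw [hset]
        exact LinearIndepOn.image_of_comp Sum.inl _ (he j)
    · cases j using Fin.cases with
      | zero => exact top_le_iff.1 (hN ▸ (hdF N).trans (span_mono (Set.image_subset_range _ _)))
      | succ j =>
        refine top_le_iff.1 ((hspan j).symm.le.trans (span_mono ?_))
        rintro _ ⟨i, rfl⟩
        exact ⟨Sum.inl i, rfl⟩
    · cases j using Fin.cases with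
      | zero =>
        rintro (i | x)
        · exact subset_span rfl
        · change f 0 (0 : A (Fin.succ 0)) ∈ _
          rw [map_zero]; exact zero_mem _
      | succ j =>
        rintro (i | x)
        · exact hfe j i
        · change f j.succ (0 : A j.succ.succ) ∈ _
          rw [map_zero]; exact zero_mem _

theorem exists_isBasisMod_extension (N : Submodule k X) {e : ι → X}
    (he : LinearIndepOn k (N.mkQ ∘ e) {i | e i ≠ 0}) :
    ∃ d : X → X, IsBasisMod N (Sum.elim e d) := by
  classical
  set s : Set (ι ⊕ X) := Sum.inl '' {i | e i ≠ 0} with hs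
  have h : LinearIndepOn k (N.mkQ ∘ Sum.elim e id) s := LinearIndepOn.image_of_comp Sum.inl _ he
  obtain ⟨b, -, hsb, hspan, hb⟩ := exists_linearIndepOn_extension h
    (Set.subset_univ s)
  refine ⟨fun x => if Sum.inr x ∈ b then x else 0, ?_, ?_⟩
  · refine LinearIndepOn.congr (hb.mono ?_) ?_ (v := N.mkQ ∘ Sum.elim e id)
    · rintro (i | x) hi
      · exact hsb ⟨i, hi, rfl⟩
      · by_contra h
        exact hi (if_neg h)
    · rintro (i | x) hi
      · rfl
      · simp only [Set.mem_ofPred_eq, Sum.elim_inr, ne_eq, ite_eq_right_iff, not_forall] at hi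
        simp [if_pos hi.1]
  · rw [eq_top_iff, ← N.ker_mkQ, sup_comm, ← LinearMap.map_le_map_iff, map_span,
      ← Set.range_comp]
    rintro _ ⟨x, -, rfl⟩
    refine span_le.2 ?_ (hspan ⟨Sum.inr x, trivial, rfl⟩)
    rintro _ ⟨i | y, hi, rfl⟩
    · exact subset_span ⟨Sum.inl i, rfl⟩
    · exact subset_span ⟨Sum.inr y, by simp [if_pos hi]⟩

theorem IsBasisMod.of_comp {κ : Type} {N : Submodule k X} {e : κ → X} (φ : ι → κ)
    (h : IsBasisMod N (e ∘ φ)) (h0 : ∀ i ∉ Set.range φ, e i = 0) : IsBasisMod N e := by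
  refine ⟨(LinearIndepOn.image_of_comp φ _ h.1).mono fun i hi => ?_, top_le_iff.1 ?_⟩
  · obtain ⟨j, rfl⟩ := not_imp_comm.1 (h0 i) hi
    exact ⟨j, hi, rfl⟩
  · rw [← h.2]
    exact sup_le_sup_left (span_mono (Set.range_comp_subset_range φ e)) _

theorem isBasisMod_span_image {e : ι → X} (he : LinearIndepOn k e {i | e i ≠ 0})
    (hspan : span k (Set.range e) = ⊤) (w : Set ι) [DecidablePred (· ∈ w)] :
    IsBasisMod (span k (e '' w)) fun i => if i ∈ w then 0 else e i := by
  constructor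
  · rw [← span_image_inter_ne_zero]
    have hdisj : Disjoint (w ∩ {i | e i ≠ 0}) (wᶜ ∩ {i | e i ≠ 0}) :=
      disjoint_compl_right.mono Set.inter_subset_left Set.inter_subset_left
    have := ((he.mono Set.inter_subset_right).quotient_iff_union hdisj).2
      (he.mono (Set.union_subset Set.inter_subset_right Set.inter_subset_right))
    have hw : ∀ i, (if i ∈ w then 0 else e i) ≠ 0 → i ∉ w := fun i hi hiw => hi (if_pos hiw)
    refine (this.mono fun i hi => ⟨hw i hi, ?_⟩).congr fun i hi => ?_
    · exact fun h0 => hi ((if_neg (hw i hi)).trans h0)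
    · simp [hw i hi]
  · rw [eq_top_iff, ← hspan, span_le]
    rintro _ ⟨i, rfl⟩
    by_cases hi : i ∈ w
    · exact mem_sup_left (subset_span ⟨i, hi, rfl⟩)
    · exact mem_sup_right (subset_span ⟨i, if_neg hi⟩)

theorem exists_isBasisMod_map {e : ι → X} (he : LinearIndepOn k e {i | e i ≠ 0})
    {L U : Submodule k X} [DecidablePred (· ∈ L)] (hL : L ≤ span k (e '' {i | e i ∈ L})) (hU : U ≤ L) (g : X →ₗ[k] Y)
    (hg : LinearMap.ker g ≤ L) :
    ∃ d : Y → Y, IsBasisMod (U.map g) (Sum.elim (fun i => if e i ∈ L then 0 else g (e i)) d) := by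
  refine exists_isBasisMod_extension _ ?_
  have hker : LinearMap.ker ((U.map g).mkQ ∘ₗ g) ≤ L := by
    rw [LinearMap.ker_comp, ker_mkQ, comap_map_eq]
    exact sup_le hU hg
  have h : LinearIndepOn k (((U.map g).mkQ ∘ₗ g) ∘ e) {i | e i ∉ L} := by
    refine LinearIndependent.map (v := fun i : {i | e i ∉ L} => e i)
      (he.mono fun i hi h0 => hi (h0 ▸ zero_mem L)) ?_
    rw [← Set.image_eq_range]
    exact (disjoint_span_image_of_ne_zero he (s := {i | e i ∉ L}) (t := {i | e i ∈ L})
      (Set.disjoint_left.2 fun i hi hi' => hi hi')).mono_right (hker.trans hL)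
  have hc : ∀ i, (if e i ∈ L then 0 else g (e i)) ≠ 0 → e i ∉ L := fun i hi h => hi (if_pos h)
  refine (h.mono fun i hi => hc i hi).congr fun i hi => ?_
  simp [hc i hi]

end LinearAlgebra

section InternalSum

open Submodule DirectSum

variable {k : Type} [Field k] {ι X Y : Type} [AddCommGroup X] [Module k X]
  [AddCommGroup Y] [Module k Y]

/-- The natural map from an external direct sum of submodules. -/
noncomputable def sumMap (N : Submodule k X) (F : ι → Submodule k X) :
    (N × ⨁ i, F i) →ₗ[k] X :=
  letI := Classical.decEq ι
  N.subtype.coprod (toModule k ι X fun i => (F i).subtype)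

theorem sumMap_bijective {N : Submodule k X} {e : ι → X} (h : IsBasisMod N e) :
    Function.Bijective (sumMap N fun i => span k {e i}) := by
  classical
  let := Classical.decEq ι
  constructor
  · rw [injective_iff_map_eq_zero]
    rintro ⟨n, x⟩ hx
    have hc : ∀ i, ∃ c : k, c • e i = x i := fun i => mem_span_singleton.1 (x i).2
    choose c hc using hc
    have hsum : (toModule k ι X fun i => (span k {e i}).subtype) x =
        ∑ i ∈ DFinsupp.support x, c i • e i := by
      simp only [hc]
      exact DirectSum.coeLinearMap_eq_dfinsuppSum _ x
    have hx0 : (n : X) + ∑ i ∈ DFinsupp.support x, c i • e i = 0 := by rw [← hsum]; exact hx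
    have hq : ∑ i ∈ DFinsupp.support x, c i • (N.mkQ ∘ e) i = 0 := by
      have := congrArg N.mkQ hx0
      rw [map_add, map_sum, map_zero, mkQ_apply, (Submodule.Quotient.mk_eq_zero N).2 n.2,
        zero_add] at this
      simpa only [map_smul, Function.comp_apply] using this
    have hsupp : (DFinsupp.support x : Set ι) ⊆ {i | e i ≠ 0} := by
      intro i hi h0
      exact (DFinsupp.mem_support_iff.1 hi) (Subtype.ext ((hc i).symm.trans
        ((congrArg (c i • ·) h0).trans (smul_zero _))))
    have hci := linearIndepOn_finset_iff.1 (h.1.mono hsupp) c hq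
    have hxz : x = 0 := by
      refine DFinsupp.ext fun i => ?_
      by_contra hi
      exact hi (Subtype.ext ((hc i).symm.trans ((congrArg (· • e i)
        (hci i (DFinsupp.mem_support_iff.2 hi))).trans (zero_smul k _))))
    subst hxz
    have hn : (n : X) = 0 := by simpa [sumMap] using hx
    exact Prod.ext (Subtype.ext hn) rfl
  · rw [← LinearMap.range_eq_top, eq_top_iff, ← h.2]
    refine sup_le (fun n hn => ⟨(⟨n, hn⟩, 0), by simp [sumMap]⟩) (span_le.2 ?_)
    rintro _ ⟨i, rfl⟩
    exact ⟨(0, lof k ι (fun i => span k {e i}) i ⟨e i, subset_span rfl⟩), by simp [sumMap]⟩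

theorem sumMap_naturality (g : X →ₗ[k] Y) {N : Submodule k X} {N' : Submodule k Y}
    {F : ι → Submodule k X} {F' : ι → Submodule k Y} (hN : ∀ x ∈ N, g x ∈ N')
    (hF : ∀ i, ∀ x ∈ F i, g x ∈ F' i) (x : N × ⨁ i, F i) :
    letI := Classical.decEq ι
    sumMap N' F' (LinearMap.prodMap (g.restrict hN) (toModule k ι (⨁ i, F' i)
      fun i => (lof k ι (fun j => F' j) i).comp (g.restrict (hF i))) x) =
      g (sumMap N F x) := by
  let := Classical.decEq ι
  obtain ⟨n, x⟩ := x
  suffices h : (toModule k ι Y fun i => (F' i).subtype) ∘ₗ (toModule k ι (⨁ i, F' i)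
      fun i => (lof k ι (fun j => F' j) i).comp (g.restrict (hF i))) =
      g ∘ₗ (toModule k ι X fun i => (F i).subtype) by
    have := LinearMap.congr_fun h x
    simp only [LinearMap.comp_apply] at this
    simp [sumMap, this]
  ext i y
  simp

end InternalSum

namespace DRep

open Submodule

variable {k : Type} [Field k] {m : ℕ}

/-- The vertex of the arm at which the two tips are attached. -/
abbrev base (m : ℕ) : Fin (m + 1) := ⟨0, Nat.succ_pos m⟩

/-- The subrepresentation on a compatible family of subspaces. -/
def subrep (M : DRep k m) (U₁ : Submodule k M.T1) (U₂ : Submodule k M.T2)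
    (U : ∀ j, Submodule k (M.A j)) (h₁ : ∀ x ∈ U (base m), M.p1 x ∈ U₁)
    (h₂ : ∀ x ∈ U (base m), M.p2 x ∈ U₂)
    (h : ∀ j : Fin m, ∀ x ∈ U j.succ, M.f j x ∈ U j.castSucc) : DRep k m where
  T1 := U₁
  T2 := U₂
  A j := U j
  acgA j := inferInstanceAs (AddCommGroup (U j))
  modA j := inferInstanceAs (Module k (U j))
  p1 := M.p1.restrict h₁
  p2 := M.p2.restrict h₂
  f j := (M.f j).restrict (h j)

theorem map_mem_span_singleton {X Y : Type} [AddCommGroup X] [Module k X] [AddCommGroup Y]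
    [Module k Y] (g : X →ₗ[k] Y) {a : X} {b : Y} (h : g a ∈ span k {b}) :
    ∀ x ∈ span k {a}, g x ∈ span k {b} := fun x hx => by
  obtain ⟨c, rfl⟩ := mem_span_singleton.1 hx
  rw [map_smul]; exact smul_mem _ _ h

/-- Families of vectors that form bases modulo a subrepresentation and are respected by the
structure maps up to scalars split the representation into that subrepresentation and a direct
sum of thin ones. -/
theorem exists_iso_prod_dsum (M : DRep k m) {U₁ : Submodule k M.T1} {U₂ : Submodule k M.T2}
    {U : ∀ j, Submodule k (M.A j)} (h₁ : ∀ x ∈ U (base m), M.p1 x ∈ U₁)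
    (h₂ : ∀ x ∈ U (base m), M.p2 x ∈ U₂)
    (h : ∀ j : Fin m, ∀ x ∈ U j.succ, M.f j x ∈ U j.castSucc)
    {ι : Type} {e₁ : ι → M.T1} {e₂ : ι → M.T2} {e : ∀ j, ι → M.A j}
    (b₁ : IsBasisMod U₁ e₁) (b₂ : IsBasisMod U₂ e₂) (b : ∀ j, IsBasisMod (U j) (e j))
    (c₁ : ∀ i, M.p1 (e (base m) i) ∈ span k {e₁ i})
    (c₂ : ∀ i, M.p2 (e (base m) i) ∈ span k {e₂ i})
    (c : ∀ j i, M.f j (e j.succ i) ∈ span k {e j.castSucc i}) :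
    ∃ F : ι → DRep k m, (∀ i, (F i).Thin) ∧
      Nonempty (Iso M ((M.subrep U₁ U₂ U h₁ h₂ h).prod (dsum F))) := by
  have rank_le : ∀ {X : Type} [AddCommGroup X] [Module k X] (x : X),
      Module.rank k (span k {x}) ≤ 1 := fun x => (rank_span_le _).trans (by simp)
  refine ⟨fun i => M.subrep (span k {e₁ i}) (span k {e₂ i}) (fun j => span k {e j i})
    (map_mem_span_singleton _ (c₁ i)) (map_mem_span_singleton _ (c₂ i))
    fun j => map_mem_span_singleton _ (c j i),
    fun i => ⟨rank_le _, rank_le _, fun j => rank_le _⟩, ⟨?_⟩⟩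
  let E₁ := LinearEquiv.ofBijective _ (sumMap_bijective b₁)
  let E₂ := LinearEquiv.ofBijective _ (sumMap_bijective b₂)
  let E := fun j => LinearEquiv.ofBijective _ (sumMap_bijective (b j))
  refine
    { g1 := E₁.symm
      g2 := E₂.symm
      gA := fun j => (E j).symm
      comm1 := fun x => ?_
      comm2 := fun x => ?_
      commf := fun j x => ?_ }
  · refine E₁.symm_apply_eq.2 ?_
    have := sumMap_naturality M.p1 h₁ (fun i => map_mem_span_singleton _ (c₁ i))
      ((E (base m)).symm x)
    exact (this.trans (congrArg M.p1 ((E (base m)).apply_symm_apply x))).symm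
  · refine E₂.symm_apply_eq.2 ?_
    have := sumMap_naturality M.p2 h₂ (fun i => map_mem_span_singleton _ (c₂ i))
      ((E (base m)).symm x)
    exact (this.trans (congrArg M.p2 ((E (base m)).apply_symm_apply x))).symm
  · refine (E j.castSucc).symm_apply_eq.2 ?_
    have := sumMap_naturality (M.f j) (h j) (fun i => map_mem_span_singleton _ (c j i))
      ((E j.succ).symm x)
    exact (this.trans (congrArg (M.f j) ((E j.succ).apply_symm_apply x))).symm

/-- A subspace complementing `ker p₁ ⊓ ker p₂` in `ker p₁ ⊔ ker p₂` carries an object of the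
subcategory `B̌`. -/
theorem subrep_inB (M : DRep k m) {U : ∀ j, Submodule k (M.A j)}
    (h : ∀ j : Fin m, ∀ x ∈ U j.succ, M.f j x ∈ U j.castSucc)
    (hU : U (base m) ≤ LinearMap.ker M.p1 ⊔ LinearMap.ker M.p2)
    (hdisj : Disjoint (U (base m)) (LinearMap.ker M.p1 ⊓ LinearMap.ker M.p2))
    (hsup : LinearMap.ker M.p1 ⊔ LinearMap.ker M.p2 ≤
      U (base m) ⊔ (LinearMap.ker M.p1 ⊓ LinearMap.ker M.p2)) :
    (M.subrep ((U (base m)).map M.p1) ((U (base m)).map M.p2) U (fun _ => mem_map_of_mem)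
      (fun _ => mem_map_of_mem) h).InB := by
  constructor
  · rintro ⟨x, hx⟩ ⟨y, hy⟩ hxy
    have hxy₁ : M.p1 x = M.p1 y := congrArg Subtype.val (congrArg Prod.fst hxy)
    have hxy₂ : M.p2 x = M.p2 y := congrArg Subtype.val (congrArg Prod.snd hxy)
    refine Subtype.ext (sub_eq_zero.1 (disjoint_def.1 hdisj _ (sub_mem hx hy) ⟨?_, ?_⟩))
    · exact LinearMap.sub_mem_ker_iff.2 hxy₁
    · exact LinearMap.sub_mem_ker_iff.2 hxy₂
  · rintro ⟨⟨_, x, hx, rfl⟩, ⟨_, y, hy, rfl⟩⟩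
    obtain ⟨a, ha, b, hb, rfl⟩ := mem_sup.1 (hU hx)
    obtain ⟨a', ha', b', hb', rfl⟩ := mem_sup.1 (hU hy)
    obtain ⟨u, hu, z, ⟨hz₁, hz₂⟩, huz⟩ := mem_sup.1 (hsup (add_mem (mem_sup_left ha')
      (mem_sup_right hb)))
    simp only [SetLike.mem_coe, LinearMap.mem_ker] at ha hb ha' hb' hz₁ hz₂
    have hu₁ := congrArg M.p1 huz
    have hu₂ := congrArg M.p2 huz
    rw [map_add, map_add, hz₁, ha', add_zero, zero_add] at hu₁
    rw [map_add, map_add, hz₂, hb, add_zero, add_zero] at hu₂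
    refine ⟨⟨u, hu⟩, Prod.ext (Subtype.ext ?_) (Subtype.ext ?_)⟩
    · change M.p1 u = M.p1 (a + b)
      rw [hu₁, map_add, ha, zero_add]
    · change M.p2 u = M.p2 (a' + b')
      rw [hu₂, map_add, hb', add_zero]

end DRep

/-- (Here `DRep k m` is the category of all, not necessarily
finite-dimensional, representations of `Q(n)` with `n = m + 3`; `n ≥ 4` means `m ≥ 1`.)
Every representation of `Q(n)` is the direct sum of a representation in `B̌` and a direct
sum of thin representations. -/
theorem stmt11 (k : Type) [Field k] (m : ℕ) (hm : 1 ≤ m) (M : DRep k m) :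
    ∃ (N : DRep k m) (ι : Type) (F : ι → DRep k m),
      N.InB ∧ (∀ i, (F i).Thin) ∧
      Nonempty (DRep.Iso M (N.prod (DRep.dsum F))) := by
  classical
  let K := LinearMap.ker M.p1 ⊓ LinearMap.ker M.p2
  let L := LinearMap.ker M.p1 ⊔ LinearMap.ker M.p2
  let F : ℕ → Submodule k (M.A (DRep.base m)) := fun
    | 0 => K
    | 1 => L
    | _ + 2 => ⊤
  have hF : Monotone F := monotone_nat_of_le_succ fun
    | 0 => inf_le_sup
    | _ + 1 => le_top
  obtain ⟨ι, e, he, hspan, hfe, hadapt⟩ := exists_chain_basis m M.A M.f F hF 2 rfl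
  have hK : K ≤ Submodule.span k (e (DRep.base m) '' {i | e (DRep.base m) i ∈ K}) := hadapt 0
  have hL : L ≤ Submodule.span k (e (DRep.base m) '' {i | e (DRep.base m) i ∈ L}) := hadapt 1
  let w : Set ι := {i | e (DRep.base m) i ∈ L ∧ e (DRep.base m) i ∉ K}
  let U : ∀ j, Submodule k (M.A j) := fun j => Submodule.span k (e j '' w)
  have hUL : U (DRep.base m) ≤ L := Submodule.span_le.2 (by rintro _ ⟨i, hi, rfl⟩; exact hi.1)
  have hU : ∀ j : Fin m, ∀ x ∈ U j.succ, M.f j x ∈ U j.castSucc := fun j => by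
    refine fun x hx => Submodule.span_le (p := (U j.castSucc).comap (M.f j)).2 ?_ hx
    rintro _ ⟨i, hi, rfl⟩
    exact Submodule.span_mono (Set.singleton_subset_iff.2 (Set.mem_image_of_mem _ hi)) (hfe j i)
  have hInB := M.subrep_inB hU hUL
    ((disjoint_span_image_of_ne_zero (he (DRep.base m)) (s := w) (t := {i | e (DRep.base m) i ∈ K})
      (Set.disjoint_left.2 fun i hi hi' => hi.2 hi')).mono_right hK)
    (hL.trans (Submodule.span_le.2 (by
      rintro _ ⟨i, hi, rfl⟩
      by_cases hiK : e (DRep.base m) i ∈ K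
      · exact Submodule.mem_sup_right hiK
      · have hiw : i ∈ w := ⟨hi, hiK⟩
        exact Submodule.mem_sup_left (Submodule.subset_span (Set.mem_image_of_mem _ hiw)))))
  obtain ⟨d₁, hd₁⟩ := exists_isBasisMod_map (he (DRep.base m)) hL hUL M.p1 le_sup_left
  obtain ⟨d₂, hd₂⟩ := exists_isBasisMod_map (he (DRep.base m)) hL hUL M.p2 le_sup_right
  let κ := ι ⊕ (M.T1 ⊕ M.T2)
  let e₁ : κ → M.T1 :=
    Sum.elim (fun i => if e (DRep.base m) i ∈ L then 0 else M.p1 (e (DRep.base m) i)) (Sum.elim d₁ 0)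
  let e₂ : κ → M.T2 :=
    Sum.elim (fun i => if e (DRep.base m) i ∈ L then 0 else M.p2 (e (DRep.base m) i)) (Sum.elim 0 d₂)
  let e' : ∀ j, κ → M.A j := fun j => Sum.elim (fun i => if i ∈ w then 0 else e j i) 0
  have b₁ : IsBasisMod ((U (DRep.base m)).map M.p1) e₁ := by
    refine IsBasisMod.of_comp (Sum.map id Sum.inl) ?_ ?_
    · convert hd₁ using 1
      exact funext fun i => by rcases i with i | x <;> rfl
    · rintro (i | x | x) hi
      · exact absurd ⟨Sum.inl i, rfl⟩ hi
      · exact absurd ⟨Sum.inr x, rfl⟩ hi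
      · rfl
  have b₂ : IsBasisMod ((U (DRep.base m)).map M.p2) e₂ := by
    refine IsBasisMod.of_comp (Sum.map id Sum.inr) ?_ ?_
    · convert hd₂ using 1
      exact funext fun i => by rcases i with i | x <;> rfl
    · rintro (i | x | x) hi
      · exact absurd ⟨Sum.inl i, rfl⟩ hi
      · rfl
      · exact absurd ⟨Sum.inr x, rfl⟩ hi
  have b : ∀ j, IsBasisMod (U j) (e' j) := fun j => by
    refine IsBasisMod.of_comp Sum.inl (isBasisMod_span_image (he j) (hspan j) w) ?_
    rintro (i | x) hi
    · exact absurd ⟨i, rfl⟩ hi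
    · rfl
  have htip : ∀ {T : Type} [AddCommGroup T] [Module k T] (p : M.A (DRep.base m) →ₗ[k] T)
      (_ : K ≤ LinearMap.ker p) (i : ι), p (if i ∈ w then 0 else e (DRep.base m) i) ∈
        Submodule.span k {if e (DRep.base m) i ∈ L then 0 else p (e (DRep.base m) i)} := fun p hp i => by
    by_cases hi : e (DRep.base m) i ∈ L
    · by_cases hiK : e (DRep.base m) i ∈ K
      · rw [if_neg fun h : i ∈ w => h.2 hiK, LinearMap.mem_ker.1 (hp hiK)]
        exact zero_mem _
      · rw [if_pos (show i ∈ w from ⟨hi, hiK⟩), map_zero]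
        exact zero_mem _
    · rw [if_neg fun h : i ∈ w => hi h.1, if_neg hi]
      exact Submodule.subset_span rfl
  obtain ⟨G, hG, hiso⟩ := M.exists_iso_prod_dsum (fun _ => Submodule.mem_map_of_mem)
    (fun _ => Submodule.mem_map_of_mem) hU b₁ b₂ b
    (by
      rintro (i | x)
      · exact htip M.p1 inf_le_left i
      · exact (map_zero M.p1).symm ▸ zero_mem _)
    (by
      rintro (i | x)
      · exact htip M.p2 inf_le_right i
      · exact (map_zero M.p2).symm ▸ zero_mem _)
    (by
      rintro j (i | x)
      · by_cases hi : i ∈ w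
        · simp [e', hi]
        · simpa [e', hi] using hfe j i
      · simp [e'])
  exact ⟨_, κ, G, hInB, hG, hiso⟩
end

section
/- Every (possibly infinite-dimensional) representation of a quiver Q(n) of type D_n (n ≥ 3, with the orientation: arrows 3 → 1, 3 → 2, and i+1 → i for 3 ≤ i < n) is a direct sum of finite-dimensional indecomposable representations. -/
section Lattice

variable {α : Type*} [CompleteLattice α] [IsModularLattice α]

theorem iSupIndep_sumElim {ι κ : Type*} {s : ι → α} {t : κ → α} (hs : iSupIndep s)
    (ht : iSupIndep t) (hst : Disjoint (⨆ i, s i) (⨆ j, t j)) : iSupIndep (Sum.elim s t) := by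
  rintro (i | i)
  · have h : Disjoint (s i) ((⨆ (j) (_ : j ≠ i), s j) ⊔ ⨆ j, t j) := by
      refine (hs i).disjoint_sup_right_of_disjoint_sup_left (hst.mono_left ?_)
      exact sup_le (le_iSup s i) (iSup₂_le fun j _ => le_iSup s j)
    refine h.mono_right (iSup₂_le ?_)
    rintro (j | j) hj
    · exact le_sup_of_le_left (le_iSup₂_of_le j (by simpa using hj) le_rfl)
    · exact le_sup_of_le_right (le_iSup t j)
  · have h : Disjoint (t i) ((⨆ (j) (_ : j ≠ i), t j) ⊔ ⨆ j, s j) := by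
      refine (ht i).disjoint_sup_right_of_disjoint_sup_left (hst.symm.mono_left ?_)
      exact sup_le (le_iSup t i) (iSup₂_le fun j _ => le_iSup t j)
    refine h.mono_right (iSup₂_le ?_)
    rintro (j | j) hj
    · exact le_sup_of_le_right (le_iSup s j)
    · exact le_sup_of_le_left (le_iSup₂_of_le j (by simpa using hj) le_rfl)

/-- A disjoint pair below `b` extends to a relative complement decomposition of `b`. -/
theorem exists_disjoint_sup_eq_of_disjoint [ComplementedLattice α] {u d b : α} (hu : u ≤ b)
    (hd : d ≤ b) (h : Disjoint u d) : ∃ c, d ≤ c ∧ c ≤ b ∧ Disjoint u c ∧ u ⊔ c = b := by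
  obtain ⟨c, hc, hsup⟩ := IsModularLattice.exists_disjoint_and_sup_eq (sup_le hu hd)
  rw [sup_assoc] at hsup
  exact ⟨d ⊔ c, le_sup_left, hsup ▸ le_sup_right,
    h.disjoint_sup_right_of_disjoint_sup_left hc, hsup⟩

end Lattice

section Flag

variable {k : Type*} [Field k]

/-- A filtration splits along a submodule of its top member. -/
theorem exists_disjoint_flag_eq_sup {V : Type*} [AddCommGroup V] [Module k V] (n : ℕ)
    (I : ℕ → Submodule k V) (hI : Antitone I) (hn : I n = ⊥) (U : Submodule k V) (hU : U ≤ I 0) :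
    ∃ D ≤ I 0, Disjoint U D ∧ ∀ j, I j ≤ I j ⊓ U ⊔ I j ⊓ D := by
  induction n generalizing I U with
  | zero => exact ⟨⊥, bot_le, disjoint_bot_right, fun j => by
      simp [le_bot_iff.1 ((hI (Nat.zero_le j)).trans hn.le)]⟩
  | succ n ih =>
    obtain ⟨D', hD', hdis, hI'⟩ := ih (fun j => I (j + 1)) (fun a b h => hI (by omega)) hn
      (U ⊓ I 1) inf_le_right
    have hUD : Disjoint U D' := by
      rw [disjoint_iff] at hdis ⊢
      rwa [inf_assoc, inf_eq_right.2 hD'] at hdis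
    obtain ⟨D, h₁, h₂, h₃, h₄⟩ := exists_disjoint_sup_eq_of_disjoint hU
      (hD'.trans (hI (Nat.zero_le 1))) hUD
    refine ⟨D, h₂, h₃, ?_⟩
    rintro (_ | j)
    · rw [inf_eq_right.2 hU, inf_eq_right.2 h₂, h₄]
    · exact (hI' j).trans (sup_le_sup (inf_le_inf_left _ inf_le_left) (inf_le_inf_left _ h₁))

theorem exists_iSupIndep_finite {V : Type} [AddCommGroup V] [Module k V] (X : Submodule k V) :
    ∃ (ι : Type) (S : ι → Submodule k V),
      iSupIndep S ∧ ⨆ i, S i = X ∧ ∀ i, Module.Finite k (S i) := by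
  let b := Module.Basis.ofVectorSpace k X
  refine ⟨_, fun i => Submodule.span k {(b i : V)}, ?_, ?_, fun i => inferInstance⟩
  · exact (b.linearIndependent.map' X.subtype X.ker_subtype).iSupIndep_span_singleton
  · have h := congrArg (Submodule.map X.subtype) b.span_eq
    rw [Submodule.map_span, Submodule.map_top, Submodule.range_subtype] at h
    rw [← Set.range_comp] at h
    rw [← Submodule.span_range_eq_iSup]
    exact h

/-- A finite filtration is a direct sum of filtrations of finite-dimensional spaces. -/
theorem exists_iSupIndep_flag {V : Type} [AddCommGroup V] [Module k V] (n : ℕ)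
    (I : ℕ → Submodule k V) (hI : Antitone I) (hn : I n = ⊥) :
    ∃ (ι : Type) (S : ι → Submodule k V), iSupIndep S ∧ ⨆ i, S i = I 0 ∧
      (∀ i, Module.Finite k (S i)) ∧ ∀ j, I j ≤ ⨆ i, I j ⊓ S i := by
  induction n generalizing I with
  | zero => exact ⟨Empty, fun _ => ⊥, fun i => i.elim, by simp [hn], fun i => i.elim, fun j => by
      simp [le_bot_iff.1 ((hI (Nat.zero_le j)).trans hn.le)]⟩
  | succ n ih =>
    obtain ⟨ι, S, hS, hS0, hfin, hSI⟩ := ih (fun j => I (j + 1)) (fun a b h => hI (by omega)) hn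
    obtain ⟨G, -, hG, hdis, hsup⟩ := exists_disjoint_sup_eq_of_disjoint
      (hI (Nat.zero_le 1)) bot_le disjoint_bot_right
    obtain ⟨κ, T, hT, hT0, hfinT⟩ := exists_iSupIndep_finite G
    have h0 : ⨆ i, Sum.elim S T i = I 0 := by
      rw [iSup_sum]; simp only [Sum.elim_inl, Sum.elim_inr]; rw [hS0, hT0]; exact hsup
    refine ⟨ι ⊕ κ, Sum.elim S T, iSupIndep_sumElim hS hT (by rwa [hS0, hT0]), h0,
      by rintro (i | i); exacts [hfin i, hfinT i], ?_⟩
    rintro (_ | j)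
    · refine h0.ge.trans (iSup_mono fun i => le_inf ?_ le_rfl)
      exact (le_iSup _ i).trans h0.le
    · rw [iSup_sum]
      exact (hSI j).trans le_sup_left

theorem iSupIndep_map_of_disjoint_ker {V W ι : Type*} [AddCommGroup V] [Module k V]
    [AddCommGroup W] [Module k W] (f : V →ₗ[k] W) {S : ι → Submodule k V} (hS : iSupIndep S)
    (hf : Disjoint (⨆ i, S i) (LinearMap.ker f)) : iSupIndep fun i => (S i).map f := by
  intro i
  simp only [← Submodule.map_iSup]
  rw [Submodule.disjoint_def]
  rintro _ ⟨x, hx, rfl⟩ ⟨y, hy, hxy⟩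
  have hle : (⨆ (j) (_ : j ≠ i), S j) ≤ ⨆ i, S i := iSup₂_le fun j _ => le_iSup S j
  have hd := (Submodule.disjoint_def.1 hf) (x - y)
    (sub_mem (le_iSup S i hx) (hle hy)) (by simp [hxy])
  obtain rfl := sub_eq_zero.1 hd
  rw [(Submodule.disjoint_def.1 (hS i)) x hx hy, map_zero]

/-- Pulling back a decomposition along a map injective on `C`. -/
theorem iSupIndep_inf_comap {V E ι : Type*} [AddCommGroup V] [Module k V] [AddCommGroup E]
    [Module k E] (C : Submodule k V) (g : V →ₗ[k] E) (hg : Disjoint C (LinearMap.ker g))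
    {S : ι → Submodule k E} (hS : iSupIndep S) (hfin : ∀ i, Module.Finite k (S i))
    (hC : C.map g ≤ ⨆ i, C.map g ⊓ S i) :
    iSupIndep (fun i => C ⊓ (S i).comap g) ∧ ⨆ i, C ⊓ (S i).comap g = C ∧
      ∀ i, Module.Finite k ↥(C ⊓ (S i).comap g) := by
  have hinj : ∀ x ∈ C, g x = 0 → x = 0 := fun x hx h => Submodule.disjoint_def.1 hg x hx h
  refine ⟨fun i => ?_, le_antisymm (iSup_le fun i => inf_le_left) fun x hx => ?_, fun i => ?_⟩
  · rw [Submodule.disjoint_def]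
    rintro x ⟨hx, hxi⟩ hx'
    refine hinj x hx (Submodule.disjoint_def.1 (hS i) _ hxi ?_)
    have : (⨆ (j) (_ : j ≠ i), C ⊓ (S j).comap g) ≤ (⨆ (j) (_ : j ≠ i), S j).comap g :=
      iSup₂_le fun j hj => inf_le_right.trans
        (Submodule.comap_mono (le_iSup₂_of_le j hj le_rfl))
    exact this hx'
  · have hle : (⨆ i, C.map g ⊓ S i) ≤ (⨆ i, C ⊓ (S i).comap g).map g := by
      rw [Submodule.map_iSup]
      refine iSup_mono fun i => ?_
      rintro _ ⟨⟨y, hy, rfl⟩, hyi⟩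
      exact ⟨y, ⟨hy, hyi⟩, rfl⟩
    obtain ⟨y, hy, hyx⟩ := hle (hC ⟨x, hx, rfl⟩)
    have hyC : y ∈ C := (iSup_le fun i => inf_le_left : (⨆ i, C ⊓ (S i).comap g) ≤ C) hy
    have := hinj (x - y) (sub_mem hx hyC) (by simp [hyx])
    rwa [sub_eq_zero.1 this]
  · refine Module.Finite.of_injective
      ((g.domRestrict (C ⊓ (S i).comap g)).codRestrict (S i) fun x => x.2.2) ?_
    rw [← LinearMap.ker_eq_bot, LinearMap.ker_eq_bot']
    rintro ⟨x, hx⟩ h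
    exact Subtype.ext (hinj x hx.1 (congrArg Subtype.val h))

theorem iSupIndep_prod {V W ι : Type*} [AddCommGroup V] [Module k V]
    [AddCommGroup W] [Module k W] {S : ι → Submodule k V} {T : ι → Submodule k W}
    (hS : iSupIndep S) (hT : iSupIndep T) : iSupIndep fun i => (S i).prod (T i) := by
  intro i
  rw [Submodule.disjoint_def]
  rintro ⟨x, y⟩ ⟨hx, hy⟩ h
  have hle : (⨆ (j) (_ : j ≠ i), (S j).prod (T j)) ≤
      (⨆ (j) (_ : j ≠ i), S j).prod (⨆ (j) (_ : j ≠ i), T j) :=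
    iSup₂_le fun j hj => Submodule.prod_mono (le_iSup₂_of_le j hj le_rfl)
      (le_iSup₂_of_le j hj le_rfl)
  exact Prod.ext (Submodule.disjoint_def.1 (hS i) x hx (hle h).1)
    (Submodule.disjoint_def.1 (hT i) y hy (hle h).2)

theorem prod_iSup_le {V W ι : Type*} [AddCommGroup V] [Module k V]
    [AddCommGroup W] [Module k W] (S : ι → Submodule k V) (T : ι → Submodule k W) :
    (⨆ i, S i).prod (⨆ i, T i) ≤ ⨆ i, (S i).prod (T i) := by
  rintro ⟨x, y⟩ ⟨hx, hy⟩
  have h₁ : (⨆ i, S i) ≤ (⨆ i, (S i).prod (T i)).comap (LinearMap.inl k V W) :=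
    iSup_le fun i z hz => Submodule.mem_iSup_of_mem i ⟨hz, zero_mem _⟩
  have h₂ : (⨆ i, T i) ≤ (⨆ i, (S i).prod (T i)).comap (LinearMap.inr k V W) :=
    iSup_le fun i z hz => Submodule.mem_iSup_of_mem i ⟨zero_mem _, hz⟩
  have hx₀ : ((x, 0) : V × W) ∈ ⨆ i, (S i).prod (T i) := h₁ hx
  have hy₀ : ((0, y) : V × W) ∈ ⨆ i, (S i).prod (T i) := h₂ hy
  simpa using add_mem hx₀ hy₀

/-- Two spaces together with a finite filtration of a subspace of their product decompose into
finite-dimensional pieces. -/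
theorem exists_iSupIndep_prod_flag {V W : Type} [AddCommGroup V] [Module k V] [AddCommGroup W]
    [Module k W] (n : ℕ) (X : Submodule k V) (Y : Submodule k W) (I : ℕ → Submodule k (V × W))
    (hI : Antitone I) (hn : I n = ⊥) (h0 : I 0 ≤ X.prod Y) :
    ∃ (ι : Type) (S : ι → Submodule k V) (T : ι → Submodule k W),
      (iSupIndep S ∧ ⨆ i, S i = X ∧ ∀ i, Module.Finite k (S i)) ∧
      (iSupIndep T ∧ ⨆ i, T i = Y ∧ ∀ i, Module.Finite k (T i)) ∧
      ∀ j, I j ≤ ⨆ i, I j ⊓ (S i).prod (T i) := by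
  induction n generalizing X Y I with
  | zero =>
    obtain ⟨ι, S, hS, hS', hfS⟩ := exists_iSupIndep_finite X
    obtain ⟨κ, T, hT, hT', hfT⟩ := exists_iSupIndep_finite Y
    refine ⟨ι ⊕ κ, Sum.elim S fun _ => ⊥, Sum.elim (fun _ => ⊥) T,
      ⟨iSupIndep_sumElim hS (fun _ => disjoint_bot_left) (by simp), by simpa [iSup_sum], ?_⟩,
      ⟨iSupIndep_sumElim (fun _ => disjoint_bot_left) hT (by simp), by simpa [iSup_sum], ?_⟩,
      fun j => by simp [le_bot_iff.1 ((hI (Nat.zero_le j)).trans hn.le)]⟩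
    · rintro (i | i)
      exacts [hfS i, inferInstanceAs (Module.Finite k (⊥ : Submodule k V))]
    · rintro (i | i)
      exacts [inferInstanceAs (Module.Finite k (⊥ : Submodule k W)), hfT i]
  | succ n ih =>
    let X' := (I 0).comap (LinearMap.inl k V W)
    let Y' := (I 0).comap (LinearMap.inr k V W)
    have hXX' : X' ≤ X := fun x hx => (h0 hx).1
    have hYY' : Y' ≤ Y := fun y hy => (h0 hy).2
    have hU : X'.prod Y' ≤ I 0 := by
      rintro ⟨x, y⟩ ⟨hx, hy⟩
      have h := add_mem (show ((x, 0) : V × W) ∈ I 0 from hx) (show ((0, y) : V × W) ∈ I 0 from hy)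
      simpa using h
    obtain ⟨ι, S, T, ⟨hS, hS', hfS⟩, ⟨hT, hT', hfT⟩, hST⟩ := ih X' Y'
      (fun j => I (j + 1) ⊓ X'.prod Y') (fun a b h => inf_le_inf_right _ (hI (by omega)))
      (by simp [hn]) inf_le_right
    obtain ⟨D, hD, hUD, hID⟩ := exists_disjoint_flag_eq_sup (n + 1) I hI hn _ hU
    have hDX : ∀ x y, (x, y) ∈ D → (x ∈ X' ∨ y ∈ Y') → x = 0 ∧ y = 0 := by
      intro x y hxy h
      have hI0 := hD hxy
      have hxy' : (x, y) ∈ X'.prod Y' := by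
        rcases h with hx | hy
        · exact ⟨hx, by
            have h := sub_mem hI0 (show ((x, 0) : V × W) ∈ I 0 from hx)
            simpa [Y'] using h⟩
        · exact ⟨by
            have h := sub_mem hI0 (show ((0, y) : V × W) ∈ I 0 from hy)
            simpa [X'] using h, hy⟩
      exact Prod.mk_eq_zero.1 (Submodule.disjoint_def.1 hUD _ hxy' hxy)
    obtain ⟨C₁, hDC₁, hC₁, hd₁, hs₁⟩ := exists_disjoint_sup_eq_of_disjoint
      (d := D.map (LinearMap.fst k V W)) hXX'
      (by rintro _ ⟨z, hz, rfl⟩; exact (h0 (hD hz)).1)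
      (by
        rw [Submodule.disjoint_def]
        rintro _ hx ⟨z, hz, rfl⟩
        exact (hDX z.1 z.2 hz (Or.inl hx)).1)
    obtain ⟨C₂, hDC₂, hC₂, hd₂, hs₂⟩ := exists_disjoint_sup_eq_of_disjoint
      (d := D.map (LinearMap.snd k V W)) hYY'
      (by rintro _ ⟨z, hz, rfl⟩; exact (h0 (hD hz)).2)
      (by
        rw [Submodule.disjoint_def]
        rintro _ hx ⟨z, hz, rfl⟩
        exact (hDX z.1 z.2 hz (Or.inr hx)).2)
    obtain ⟨E₁, hdE₁, hsE₁⟩ := IsModularLattice.exists_disjoint_and_sup_eq hDC₁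
    obtain ⟨E₂, hdE₂, hsE₂⟩ := IsModularLattice.exists_disjoint_and_sup_eq hDC₂
    obtain ⟨ε₁, P, hP, hP', hfP⟩ := exists_iSupIndep_finite E₁
    obtain ⟨ε₂, Q, hQ, hQ', hfQ⟩ := exists_iSupIndep_finite E₂
    obtain ⟨δ, R, hR, hR', hfR, hRI⟩ := exists_iSupIndep_flag (n + 1) (fun j => I j ⊓ D)
      (fun a b h => inf_le_inf_right _ (hI h)) (by simp [hn])
    replace hR' : ⨆ i, R i = D := hR'.trans (inf_eq_right.2 hD)
    have hR₁ := iSupIndep_map_of_disjoint_ker (LinearMap.fst k V W) hR (by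
      rw [hR', Submodule.disjoint_def]
      rintro ⟨x, y⟩ h (rfl : x = 0)
      exact Prod.mk_eq_zero.2 (hDX _ y h (Or.inl (zero_mem _))))
    have hR₂ := iSupIndep_map_of_disjoint_ker (LinearMap.snd k V W) hR (by
      rw [hR', Submodule.disjoint_def]
      rintro ⟨x, y⟩ h (rfl : y = 0)
      exact Prod.mk_eq_zero.2 (hDX x _ h (Or.inr (zero_mem _))))
    have hR₁' : ⨆ i, (R i).map (LinearMap.fst k V W) = D.map (LinearMap.fst k V W) := by
      rw [← Submodule.map_iSup, hR']
    have hR₂' : ⨆ i, (R i).map (LinearMap.snd k V W) = D.map (LinearMap.snd k V W) := by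
      rw [← Submodule.map_iSup, hR']
    refine ⟨ι ⊕ (δ ⊕ (ε₁ ⊕ ε₂)),
      Sum.elim S (Sum.elim (fun i => (R i).map (LinearMap.fst k V W)) (Sum.elim P fun _ => ⊥)),
      Sum.elim T (Sum.elim (fun i => (R i).map (LinearMap.snd k V W)) (Sum.elim (fun _ => ⊥) Q)),
      ⟨?_, ?_, ?_⟩, ⟨?_, ?_, ?_⟩, ?_⟩
    · refine iSupIndep_sumElim hS (iSupIndep_sumElim hR₁
        (iSupIndep_sumElim hP (fun _ => disjoint_bot_left) ?_) ?_) ?_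
      · simp
      · simpa [iSup_sum, hR₁', hP'] using hdE₁
      · simpa [iSup_sum, hR₁', hP', hS', hsE₁] using hd₁
    · simpa [iSup_sum, hR₁', hP', hS', hsE₁] using hs₁
    · rintro (i | i | i | i)
      exacts [hfS i, inferInstanceAs (Module.Finite k ((R i).map (LinearMap.fst k V W))), hfP i,
        inferInstanceAs (Module.Finite k (⊥ : Submodule k V))]
    · refine iSupIndep_sumElim hT (iSupIndep_sumElim hR₂
        (iSupIndep_sumElim (fun _ => disjoint_bot_left) hQ ?_) ?_) ?_
      · simp
      · simpa [iSup_sum, hR₂', hQ'] using hdE₂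
      · simpa [iSup_sum, hR₂', hQ', hT', hsE₂] using hd₂
    · simpa [iSup_sum, hR₂', hQ', hT', hsE₂] using hs₂
    · rintro (i | i | i | i)
      exacts [hfT i, inferInstanceAs (Module.Finite k ((R i).map (LinearMap.snd k V W))),
        inferInstanceAs (Module.Finite k (⊥ : Submodule k W)), hfQ i]
    · intro j
      refine (hID j).trans ?_
      rw [iSup_sum, iSup_sum]
      refine sup_le_sup ?_ (le_sup_of_le_left ?_)
      · rcases j with _ | j
        · refine inf_le_right.trans ?_
          rw [← hS', ← hT']
          refine (prod_iSup_le S T).trans (iSup_mono fun i => le_inf ?_ le_rfl)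
          refine le_trans (Submodule.prod_mono ?_ ?_) hU
          · exact hS' ▸ le_iSup S i
          · exact hT' ▸ le_iSup T i
        · exact (hST j).trans (iSup_mono fun i => inf_le_inf_right _ inf_le_left)
      · refine (hRI j).trans (iSup_mono fun i => inf_le_inf inf_le_left ?_)
        exact fun z hz => ⟨⟨z, hz, rfl⟩, ⟨z, hz, rfl⟩⟩

end Flag

namespace DRep

section Internal

variable {k : Type} [Field k] {m : ℕ}

/-- `S` is an independent family of finite-dimensional submodules with sum `X`. -/
def IsFinDecomp {V ι : Type} [AddCommGroup V] [Module k V] (S : ι → Submodule k V)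
    (X : Submodule k V) : Prop :=
  iSupIndep S ∧ ⨆ i, S i = X ∧ ∀ i, Module.Finite k (S i)

theorem IsFinDecomp.sumElim {V ι κ : Type} [AddCommGroup V] [Module k V]
    {S : ι → Submodule k V} {T : κ → Submodule k V} {X Y : Submodule k V}
    (hS : IsFinDecomp S X) (hT : IsFinDecomp T Y) (h : Disjoint X Y) :
    IsFinDecomp (Sum.elim S T) (X ⊔ Y) := by
  refine ⟨iSupIndep_sumElim hS.1 hT.1 (by rwa [hS.2.1, hT.2.1]), ?_, ?_⟩
  · simp [iSup_sum, hS.2.1, hT.2.1]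
  · rintro (i | i)
    exacts [hS.2.2 i, hT.2.2 i]

theorem isFinDecomp_bot {V ι : Type} [AddCommGroup V] [Module k V] :
    IsFinDecomp (fun _ : ι => (⊥ : Submodule k V)) ⊥ :=
  ⟨fun _ => disjoint_bot_left, by simp, fun _ => inferInstance⟩

/-- The subrepresentation with vertex spaces `X₁`, `X₂`, `X j` is an internal direct sum of
finite-dimensional subrepresentations. -/
def FinDecomp (M : DRep k m) (X₁ : Submodule k M.T1) (X₂ : Submodule k M.T2)
    (X : ∀ j, Submodule k (M.A j)) : Prop :=
  ∃ (ι : Type) (S₁ : ι → Submodule k M.T1) (S₂ : ι → Submodule k M.T2)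
    (S : ∀ j, ι → Submodule k (M.A j)),
    IsFinDecomp S₁ X₁ ∧ IsFinDecomp S₂ X₂ ∧ (∀ j, IsFinDecomp (S j) (X j)) ∧
    (∀ i, ∀ x ∈ S ⟨0, Nat.succ_pos m⟩ i, M.p1 x ∈ S₁ i) ∧
    (∀ i, ∀ x ∈ S ⟨0, Nat.succ_pos m⟩ i, M.p2 x ∈ S₂ i) ∧
    ∀ i (j : Fin m), ∀ x ∈ S j.succ i, M.f j x ∈ S j.castSucc i

variable {M : DRep k m}

theorem FinDecomp.sup {X₁ Y₁ : Submodule k M.T1} {X₂ Y₂ : Submodule k M.T2}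
    {X Y : ∀ j, Submodule k (M.A j)} (hX : M.FinDecomp X₁ X₂ X) (hY : M.FinDecomp Y₁ Y₂ Y)
    (h₁ : Disjoint X₁ Y₁) (h₂ : Disjoint X₂ Y₂) (h : ∀ j, Disjoint (X j) (Y j)) :
    M.FinDecomp (X₁ ⊔ Y₁) (X₂ ⊔ Y₂) fun j => X j ⊔ Y j := by
  obtain ⟨ι, S₁, S₂, S, hS₁, hS₂, hS, hp₁, hp₂, hf⟩ := hX
  obtain ⟨κ, T₁, T₂, T, hT₁, hT₂, hT, hq₁, hq₂, hg⟩ := hY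
  refine ⟨ι ⊕ κ, Sum.elim S₁ T₁, Sum.elim S₂ T₂, fun j => Sum.elim (S j) (T j),
    hS₁.sumElim hT₁ h₁, hS₂.sumElim hT₂ h₂, fun j => (hS j).sumElim (hT j) (h j), ?_, ?_, ?_⟩
  · rintro (i | i)
    exacts [hp₁ i, hq₁ i]
  · rintro (i | i)
    exacts [hp₂ i, hq₂ i]
  · rintro (i | i)
    exacts [hf i, hg i]

/-- A subrepresentation of the arm has a complement as soon as the arm maps reflect it up to
their kernels. -/
theorem exists_arm_complement (N N' : ∀ j, Submodule k (M.A j)) (hle : ∀ j, N' j ≤ N j)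
    (hN : ∀ (j : Fin m), ∀ x ∈ N j.succ, M.f j x ∈ N j.castSucc)
    (h : ∀ (j : Fin m), ∀ x ∈ N j.succ, M.f j x ∈ N' j.castSucc → x ∈ N' j.succ ∨ M.f j x = 0) :
    ∃ C : ∀ j, Submodule k (M.A j),
      (∀ j, C j ≤ N j ∧ Disjoint (N' j) (C j) ∧ N' j ⊔ C j = N j) ∧
      ∀ (j : Fin m), ∀ x ∈ C j.succ, M.f j x ∈ C j.castSucc := by
  let P : ∀ j, Submodule k (M.A j) → Prop := fun j C =>
    C ≤ N j ∧ Disjoint (N' j) C ∧ N' j ⊔ C = N j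
  have hlast : ∃ C, P (Fin.last m) C := by
    obtain ⟨C, hC, hsup⟩ := IsModularLattice.exists_disjoint_and_sup_eq (hle (Fin.last m))
    exact ⟨C, hsup ▸ le_sup_right, hC, hsup⟩
  have hstep : ∀ (j : Fin m) (C : {C // P j.succ C}),
      ∃ C' : {C // P j.castSucc C}, C.1.map (M.f j) ≤ C'.1 := by
    rintro j ⟨C, hC, hdis, -⟩
    obtain ⟨C', h₁, h₂, h₃, h₄⟩ := exists_disjoint_sup_eq_of_disjoint
      (d := C.map (M.f j)) (hle j.castSucc)
      (by rintro _ ⟨x, hx, rfl⟩; exact hN j x (hC hx))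
      (by
        rw [Submodule.disjoint_def]
        rintro _ hx' ⟨x, hx, rfl⟩
        rcases h j x (hC hx) hx' with h | h
        · rw [Submodule.disjoint_def.1 hdis x h hx, map_zero]
        · exact h)
    exact ⟨⟨C', h₂, h₃, h₄⟩, h₁⟩
  choose step hstep using hstep
  let C : ∀ j, {C // P j C} := fun j =>
    Fin.reverseInduction (motive := fun j => {C // P j C}) ⟨_, hlast.choose_spec⟩ step j
  refine ⟨fun j => (C j).1, fun j => (C j).2, fun j x hx => ?_⟩
  have hC : C j.castSucc = step j (C j.succ) := Fin.reverseInduction_castSucc ..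
  change M.f j x ∈ (C j.castSucc).1
  rw [hC]
  exact hstep j _ ⟨x, hx, rfl⟩

/-- The images of an arm in a common space form a finite filtration. -/
theorem exists_arm_flag {E : Type} [AddCommGroup E] [Module k E] (g : ∀ j, M.A j →ₗ[k] E)
    (C : ∀ j, Submodule k (M.A j)) (s : ℕ)
    (hC : ∀ (j : Fin m), ∀ x ∈ C j.succ, M.f j x ∈ C j.castSucc)
    (hg : ∀ (j : Fin m), s ≤ j → ∀ x, g j.succ x = g j.castSucc (M.f j x)) :
    ∃ I : ℕ → Submodule k E, Antitone I ∧ I (s + m + 1) = ⊥ ∧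
      ∀ j : Fin (m + 1), s ≤ j → I j = (C j).map (g j) := by
  refine ⟨fun t => if t < s then ⊤ else
    if h : t < m + 1 then (C ⟨t, h⟩).map (g ⟨t, h⟩) else ⊥, ?_, ?_, ?_⟩
  · refine antitone_nat_of_succ_le fun t => ?_
    by_cases hts : t < s
    · simp [hts]
    by_cases htm : t + 1 < m + 1
    · rw [if_neg (by omega), if_neg hts, dif_pos htm, dif_pos (by omega)]
      rintro _ ⟨x, hx, rfl⟩
      have ht : t < m := by omega
      exact ⟨M.f ⟨t, ht⟩ x, hC ⟨t, ht⟩ x hx, (hg ⟨t, ht⟩ (by simpa using hts) x).symm⟩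
    · rw [if_neg (by omega), dif_neg htm]
      exact bot_le
  · dsimp only
    rw [if_neg (by omega), dif_neg (by omega)]
  · intro j hj
    dsimp only
    rw [if_neg (by omega), dif_pos j.2]

/-- The composite maps from the arm to its vertex `s`. -/
theorem exists_arm_comp (M : DRep k m) (s : Fin (m + 1)) :
    ∃ g : ∀ j, M.A j →ₗ[k] M.A s, g s = LinearMap.id ∧
      ∀ j : Fin m, j.succ ≠ s → g j.succ = g j.castSucc ∘ₗ M.f j := by
  classical
  let g : ∀ j, M.A j →ₗ[k] M.A s := fun j =>
    Fin.induction (motive := fun j => M.A j →ₗ[k] M.A s)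
      (if h : s = 0 then h ▸ LinearMap.id else 0)
      (fun j g => if h : s = j.succ then h ▸ LinearMap.id else g ∘ₗ M.f j) j
  have hsucc : ∀ j : Fin m, g j.succ =
      if h : s = j.succ then h ▸ LinearMap.id else g j.castSucc ∘ₗ M.f j :=
    fun j => Fin.induction_succ ..
  refine ⟨g, ?_, fun j hj => by rw [hsucc, dif_neg hj.symm]⟩
  rcases Fin.eq_zero_or_eq_succ s with h | ⟨j, h⟩
  · subst h
    simp only [g, Fin.induction_zero, dif_pos]
  · subst h
    rw [hsucc, dif_pos rfl]

/-- Subrepresentations supported on the arm decompose. -/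
theorem finDecomp_arm (d ℓ : ℕ) (hd : d + ℓ = m + 1) (N : ∀ j, Submodule k (M.A j))
    (hN : ∀ (j : Fin m), ∀ x ∈ N j.succ, M.f j x ∈ N j.castSucc)
    (h₁ : ∀ x ∈ N ⟨0, Nat.succ_pos m⟩, M.p1 x = 0) (h₂ : ∀ x ∈ N ⟨0, Nat.succ_pos m⟩, M.p2 x = 0)
    (hℓ : ∀ j : Fin (m + 1), j < ℓ → N j = ⊥) : M.FinDecomp ⊥ ⊥ N := by
  induction d generalizing ℓ N with
  | zero =>
    obtain rfl : N = fun _ => ⊥ := funext fun j => hℓ j (by omega)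
    exact ⟨Empty, fun _ => ⊥, fun _ => ⊥, fun _ _ => ⊥, isFinDecomp_bot, isFinDecomp_bot,
      fun _ => isFinDecomp_bot, fun i => i.elim, fun i => i.elim, fun i => i.elim⟩
  | succ d ih =>
    let s : Fin (m + 1) := ⟨ℓ, by omega⟩
    obtain ⟨g, hgs, hg⟩ := M.exists_arm_comp s
    have hzero : ∀ j : Fin m, j.succ = s → ∀ x ∈ N j.succ, M.f j x = 0 := by
      intro j hj x hx
      have hb := hℓ j.castSucc (by have := congrArg Fin.val hj; simp [s] at this ⊢; omega)
      simpa [hb] using hN j x hx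
    have hN' : ∀ (j : Fin m), ∀ x ∈ N j.succ, g j.castSucc (M.f j x) = g j.succ x ∨
        M.f j x = 0 := by
      intro j x hx
      by_cases hj : j.succ = s
      · exact Or.inr (hzero j hj x hx)
      · exact Or.inl (by rw [hg j hj]; rfl)
    have hker := ih (ℓ + 1) (by omega) (fun j => N j ⊓ LinearMap.ker (g j))
      (by
        rintro j x ⟨hx, hgx⟩
        refine ⟨hN j x hx, ?_⟩
        rcases hN' j x hx with h | h
        · exact LinearMap.mem_ker.2 (h.trans hgx)
        · rw [h]; exact zero_mem _)
      (fun x hx => h₁ x hx.1) (fun x hx => h₂ x hx.1)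
      (by
        intro j hj
        rcases Nat.lt_succ_iff_lt_or_eq.1 hj with hj | hj
        · rw [hℓ j hj, bot_inf_eq]
        · obtain rfl : j = s := Fin.ext hj
          rw [hgs, LinearMap.ker_id, inf_bot_eq])
    obtain ⟨C, hC, hCf⟩ := exists_arm_complement N (fun j => N j ⊓ LinearMap.ker (g j))
      (fun j => inf_le_left) hN (by
        rintro j x hx ⟨-, hgx⟩
        rcases hN' j x hx with h | h
        · exact Or.inl ⟨hx, LinearMap.mem_ker.2 (h.symm.trans hgx)⟩
        · exact Or.inr h)
    have hCg : ∀ j, Disjoint (C j) (LinearMap.ker (g j)) := by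
      intro j
      rw [Submodule.disjoint_def]
      exact fun x hx hgx => Submodule.disjoint_def.1 (hC j).2.1 x ⟨(hC j).1 hx, hgx⟩ hx
    obtain ⟨I, hI, hI0, hIC⟩ := exists_arm_flag g C ℓ hCf (by
      intro j hj x
      rw [hg j (fun h => by have := congrArg Fin.val h; simp [s] at this; omega)]
      rfl)
    obtain ⟨ι, S, hS, -, hfin, hSI⟩ := exists_iSupIndep_flag _ I hI hI0
    have hdec : M.FinDecomp ⊥ ⊥ C := by
      refine ⟨ι, fun _ => ⊥, fun _ => ⊥, fun j i => C j ⊓ (S i).comap (g j), isFinDecomp_bot,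
        isFinDecomp_bot, fun j => iSupIndep_inf_comap (C j) (g j) (hCg j) hS hfin ?_, ?_, ?_, ?_⟩
      · by_cases hj : (j : ℕ) < ℓ
        · have : C j = ⊥ := le_bot_iff.1 ((hC j).1.trans (hℓ j hj).le)
          simp [this]
        · rw [← hIC j (by omega)]
          exact hSI j
      · exact fun i x hx => h₁ x ((hC _).1 hx.1)
      · exact fun i x hx => h₂ x ((hC _).1 hx.1)
      · rintro i j x ⟨hx, hxi⟩
        refine ⟨hCf j x hx, ?_⟩
        rcases hN' j x ((hC _).1 hx) with h | h
        · exact (congrArg (· ∈ S i) h).mpr hxi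
        · rw [h]; exact zero_mem _
    convert hker.sup hdec disjoint_bot_left disjoint_bot_left fun j => (hC j).2.1 using 1
    · simp
    · simp
    · exact funext fun j => (hC j).2.2.symm

/-- Every representation is an internal direct sum of finite-dimensional subrepresentations. -/
theorem finDecomp_top (M : DRep k m) : M.FinDecomp ⊤ ⊤ fun _ => ⊤ := by
  let g : ∀ j, M.A j →ₗ[k] M.T1 × M.T2 := fun j =>
    Fin.induction (motive := fun j => M.A j →ₗ[k] M.T1 × M.T2)
      (LinearMap.prod M.p1 M.p2) (fun j g => g ∘ₗ M.f j) j
  have hg0 : ∀ x, g ⟨0, Nat.succ_pos m⟩ x = (M.p1 x, M.p2 x) := fun x => rfl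
  have hg : ∀ (j : Fin m) x, g j.succ x = g j.castSucc (M.f j x) := fun j x => by
    have : g j.succ = g j.castSucc ∘ₗ M.f j := Fin.induction_succ ..
    rw [this]; rfl
  have hker : M.FinDecomp ⊥ ⊥ fun j => LinearMap.ker (g j) :=
    finDecomp_arm (m + 1) 0 rfl _
      (fun j x hx => LinearMap.mem_ker.2 ((hg j x).symm.trans hx))
      (fun x hx => congrArg Prod.fst hx) (fun x hx => congrArg Prod.snd hx) (by simp)
  obtain ⟨C, hC, hCf⟩ := exists_arm_complement (fun _ => ⊤) (fun j => LinearMap.ker (g j))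
    (fun j => le_top) (fun _ _ _ => trivial)
    (fun j x _ hx => Or.inl (LinearMap.mem_ker.2 ((hg j x).trans hx)))
  obtain ⟨I, hI, hI0, hIC⟩ := exists_arm_flag g C 0 hCf (fun j _ => hg j)
  obtain ⟨ι, S, T, hS, hT, hST⟩ := exists_iSupIndep_prod_flag _ ⊤ ⊤ I hI hI0 (by simp)
  have hfin : ∀ i, Module.Finite k ((S i).prod (T i)) := fun i =>
    .of_fg ((Module.Finite.iff_fg.1 (hS.2.2 i)).prod (Module.Finite.iff_fg.1 (hT.2.2 i)))
  have hdec : M.FinDecomp ⊤ ⊤ C := by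
    refine ⟨ι, S, T, fun j i => C j ⊓ ((S i).prod (T i)).comap (g j), hS, hT,
      fun j => iSupIndep_inf_comap (C j) (g j) (hC j).2.1.symm
        (iSupIndep_prod hS.1 hT.1) hfin ?_, ?_, ?_, ?_⟩
    · rw [← hIC j (Nat.zero_le _)]
      exact hST j
    · exact fun i x hx => hx.2.1
    · exact fun i x hx => hx.2.2
    · rintro i j x ⟨hx, hxi⟩
      refine ⟨hCf j x hx, ?_⟩
      exact (congrArg (· ∈ (S i).prod (T i)) (hg j x)).mp hxi
  convert hker.sup hdec disjoint_bot_left disjoint_bot_left fun j => (hC j).2.1 using 1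
  · simp
  · simp
  · exact funext fun j => (hC j).2.2.symm

end Internal

end DRep

namespace DRep

section External

variable {k : Type} [Field k] {m : ℕ}

/-- The inverse of an isomorphism. -/
def Iso.symm {M N : DRep k m} (e : Iso M N) : Iso N M where
  g1 := e.g1.symm
  g2 := e.g2.symm
  gA i := (e.gA i).symm
  comm1 x := by rw [LinearEquiv.symm_apply_eq, e.comm1, LinearEquiv.apply_symm_apply]
  comm2 x := by rw [LinearEquiv.symm_apply_eq, e.comm2, LinearEquiv.apply_symm_apply]
  commf i x := by rw [LinearEquiv.symm_apply_eq, e.commf, LinearEquiv.apply_symm_apply]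

/-- Composition of isomorphisms. -/
def Iso.trans {M N P : DRep k m} (e : Iso M N) (e' : Iso N P) : Iso M P where
  g1 := e.g1.trans e'.g1
  g2 := e.g2.trans e'.g2
  gA i := (e.gA i).trans (e'.gA i)
  comm1 x := by simp only [LinearEquiv.trans_apply]; rw [e.comm1, e'.comm1]
  comm2 x := by simp only [LinearEquiv.trans_apply]; rw [e.comm2, e'.comm2]
  commf i x := by simp only [LinearEquiv.trans_apply]; rw [e.commf, e'.commf]

theorem toModule_lof_comp_apply {ι : Type} [DecidableEq ι] {A B : ι → Type}
    [∀ i, AddCommGroup (A i)] [∀ i, Module k (A i)] [∀ i, AddCommGroup (B i)]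
    [∀ i, Module k (B i)] (φ : ∀ i, A i →ₗ[k] B i) (x : DirectSum ι A) (i : ι) :
    DirectSum.toModule k ι (DirectSum ι B) (fun i => (DirectSum.lof k ι B i).comp (φ i)) x i =
      φ i (x i) := by
  have h : DirectSum.component k ι B i ∘ₗ DirectSum.toModule k ι (DirectSum ι B)
      (fun i => (DirectSum.lof k ι B i).comp (φ i)) = φ i ∘ₗ DirectSum.component k ι A i := by
    ext j x
    by_cases hij : j = i
    · subst hij
      simp [DirectSum.component.lof_self]
    · simp [DirectSum.component.of, hij]
  exact LinearMap.congr_fun h x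

theorem dsum_p1_apply {ι : Type} (F : ι → DRep k m)
    (x : DirectSum ι fun i => (F i).A ⟨0, Nat.succ_pos m⟩) (i : ι) :
    DFunLike.coe (F := DirectSum ι fun i => (F i).T1) ((dsum F).p1 x) i = (F i).p1 (x i) :=
  let := Classical.decEq ι
  toModule_lof_comp_apply (fun i => (F i).p1) x i

theorem dsum_p2_apply {ι : Type} (F : ι → DRep k m)
    (x : DirectSum ι fun i => (F i).A ⟨0, Nat.succ_pos m⟩) (i : ι) :
    DFunLike.coe (F := DirectSum ι fun i => (F i).T2) ((dsum F).p2 x) i = (F i).p2 (x i) :=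
  let := Classical.decEq ι
  toModule_lof_comp_apply (fun i => (F i).p2) x i

theorem dsum_f_apply {ι : Type} (F : ι → DRep k m) (j : Fin m)
    (x : DirectSum ι fun i => (F i).A j.succ) (i : ι) :
    DFunLike.coe (F := DirectSum ι fun i => (F i).A j.castSucc) ((dsum F).f j x) i =
      (F i).f j (x i) :=
  let := Classical.decEq ι
  toModule_lof_comp_apply (fun i => (F i).f j) x i

/-- Direct sums of isomorphic families are isomorphic. -/
def dsumCongr {ι : Type} {F G : ι → DRep k m} (e : ∀ i, Iso (F i) (G i)) :
    Iso (dsum F) (dsum G) where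
  g1 := DFinsupp.mapRange.linearEquiv fun i => (e i).g1
  g2 := DFinsupp.mapRange.linearEquiv fun i => (e i).g2
  gA j := DFinsupp.mapRange.linearEquiv fun i => (e i).gA j
  comm1 x := DFinsupp.ext fun i => by
    refine ((congrArg (e i).g1 (dsum_p1_apply F x i)).trans ?_).trans (dsum_p1_apply G _ i).symm
    exact (e i).comm1 _
  comm2 x := DFinsupp.ext fun i => by
    refine ((congrArg (e i).g2 (dsum_p2_apply F x i)).trans ?_).trans (dsum_p2_apply G _ i).symm
    exact (e i).comm2 _
  commf j x := DFinsupp.ext fun i => by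
    refine ((congrArg ((e i).gA _) (dsum_f_apply F j x i)).trans ?_).trans
      (dsum_f_apply G j _ i).symm
    exact (e i).commf j _

/-- Iterated direct sums are direct sums. -/
noncomputable def dsumSigma {ι : Type} {κ : ι → Type} (G : ∀ i, κ i → DRep k m) :
    Iso (dsum fun p : Σ i, κ i => G p.1 p.2) (dsum fun i => dsum (G i)) where
  g1 := let := Classical.decEq ι
    DirectSum.sigmaLcurryEquiv k (δ := fun i j => (G i j).T1)
  g2 := let := Classical.decEq ι
    DirectSum.sigmaLcurryEquiv k (δ := fun i j => (G i j).T2)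
  gA v := let := Classical.decEq ι
    DirectSum.sigmaLcurryEquiv k (δ := fun i j => (G i j).A v)
  comm1 x := DFinsupp.ext fun i => by
    refine Eq.trans ?_ (dsum_p1_apply (fun i => dsum (G i)) _ i).symm
    refine DFinsupp.ext fun j => ?_
    refine (dsum_p1_apply _ x ⟨i, j⟩).trans (Eq.trans ?_ (dsum_p1_apply (G i) _ j).symm)
    rfl
  comm2 x := DFinsupp.ext fun i => by
    refine Eq.trans ?_ (dsum_p2_apply (fun i => dsum (G i)) _ i).symm
    refine DFinsupp.ext fun j => ?_
    refine (dsum_p2_apply _ x ⟨i, j⟩).trans (Eq.trans ?_ (dsum_p2_apply (G i) _ j).symm)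
    rfl
  commf v x := DFinsupp.ext fun i => by
    refine Eq.trans ?_ (dsum_f_apply (fun i => dsum (G i)) v _ i).symm
    refine DFinsupp.ext fun j => ?_
    refine (dsum_f_apply _ v x ⟨i, j⟩).trans (Eq.trans ?_ (dsum_f_apply (G i) v _ j).symm)
    rfl

/-- The family consisting of two given representations. -/
def pairFamily (N P : DRep k m) : Fin 2 → DRep k m := ![N, P]

/-- The binary direct sum as a direct sum of a family. -/
noncomputable def prodIsoDsum (N P : DRep k m) : Iso (N.prod P) (dsum (pairFamily N P)) where
  g1 := (LinearEquiv.piFinTwo k fun i => (pairFamily N P i).T1).symm.trans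
    (DirectSum.linearEquivFunOnFintype k (Fin 2) fun i => (pairFamily N P i).T1).symm
  g2 := (LinearEquiv.piFinTwo k fun i => (pairFamily N P i).T2).symm.trans
    (DirectSum.linearEquivFunOnFintype k (Fin 2) fun i => (pairFamily N P i).T2).symm
  gA v := (LinearEquiv.piFinTwo k fun i => (pairFamily N P i).A v).symm.trans
    (DirectSum.linearEquivFunOnFintype k (Fin 2) fun i => (pairFamily N P i).A v).symm
  comm1 x := DFinsupp.ext fun i => by
    refine Eq.trans ?_ (dsum_p1_apply (pairFamily N P) _ i).symm
    fin_cases i <;> rfl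
  comm2 x := DFinsupp.ext fun i => by
    refine Eq.trans ?_ (dsum_p2_apply (pairFamily N P) _ i).symm
    fin_cases i <;> rfl
  commf v x := DFinsupp.ext fun i => by
    refine Eq.trans ?_ (dsum_f_apply (pairFamily N P) v _ i).symm
    fin_cases i <;> rfl

/-- A representation is the direct sum of the family consisting of itself. -/
noncomputable def isoDsumUnit (M : DRep k m) : Iso M (dsum fun _ : Unit => M) where
  g1 := (LinearEquiv.funUnique Unit k M.T1).symm.trans
    (DirectSum.linearEquivFunOnFintype k Unit fun _ => M.T1).symm
  g2 := (LinearEquiv.funUnique Unit k M.T2).symm.trans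
    (DirectSum.linearEquivFunOnFintype k Unit fun _ => M.T2).symm
  gA v := (LinearEquiv.funUnique Unit k (M.A v)).symm.trans
    (DirectSum.linearEquivFunOnFintype k Unit fun _ => M.A v).symm
  comm1 x := DFinsupp.ext fun i => by
    refine Eq.trans ?_ (dsum_p1_apply (fun _ : Unit => M) _ i).symm
    rfl
  comm2 x := DFinsupp.ext fun i => by
    refine Eq.trans ?_ (dsum_p2_apply (fun _ : Unit => M) _ i).symm
    rfl
  commf v x := DFinsupp.ext fun i => by
    refine Eq.trans ?_ (dsum_f_apply (fun _ : Unit => M) v _ i).symm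
    rfl

/-- `M` is isomorphic to a direct sum of representations satisfying `Q`. -/
def IsDsumOf (Q : DRep k m → Prop) (M : DRep k m) : Prop :=
  ∃ (ι : Type) (F : ι → DRep k m), (∀ i, Q (F i)) ∧ Nonempty (Iso M (dsum F))

theorem IsDsumOf.bind {Q R : DRep k m → Prop} {M : DRep k m} (hM : M.IsDsumOf Q)
    (h : ∀ N, Q N → N.IsDsumOf R) : M.IsDsumOf R := by
  obtain ⟨ι, F, hF, ⟨e⟩⟩ := hM
  choose κ G hG e' using fun i => h (F i) (hF i)
  exact ⟨Σ i, κ i, fun p => G p.1 p.2, fun p => hG p.1 p.2,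
    ⟨(e.trans (dsumCongr fun i => (e' i).some)).trans (dsumSigma G).symm⟩⟩

theorem IsZero.isDsumOf {M : DRep k m} (hM : M.IsZero) (Q : DRep k m → Prop) :
    M.IsDsumOf Q := by
  have : Subsingleton M.T1 := ⟨fun x y => (hM.1 x).trans (hM.1 y).symm⟩
  have : Subsingleton M.T2 := ⟨fun x y => (hM.2.1 x).trans (hM.2.1 y).symm⟩
  have : ∀ v, Subsingleton (M.A v) := fun v => ⟨fun x y => (hM.2.2 v x).trans (hM.2.2 v y).symm⟩
  let F : Empty → DRep k m := Empty.elim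
  have : Subsingleton (dsum F).T1 := inferInstanceAs (Subsingleton (DirectSum Empty _))
  have : Subsingleton (dsum F).T2 := inferInstanceAs (Subsingleton (DirectSum Empty _))
  have : ∀ v, Subsingleton ((dsum F).A v) := fun v =>
    inferInstanceAs (Subsingleton (DirectSum Empty fun i => (F i).A v))
  exact ⟨Empty, F, fun i => i.elim, ⟨⟨0, 0, fun v => 0, fun _ => Subsingleton.elim _ _,
    fun _ => Subsingleton.elim _ _, fun _ _ => Subsingleton.elim _ _⟩⟩⟩

/-- The total dimension of a representation. -/
noncomputable def totalDim (M : DRep k m) : ℕ :=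
  Module.finrank k M.T1 + Module.finrank k M.T2 + ∑ v, Module.finrank k (M.A v)

theorem totalDim_pos {M : DRep k m} (hM : M.FinDim) (h : ¬ M.IsZero) : 0 < M.totalDim := by
  obtain ⟨_, _, _⟩ := hM
  contrapose! h
  simp only [totalDim, nonpos_iff_eq_zero, add_eq_zero, Finset.sum_eq_zero_iff,
    Finset.mem_univ, true_imp_iff, Module.finrank_zero_iff] at h
  obtain ⟨⟨_, _⟩, _⟩ := h
  exact ⟨fun x => Subsingleton.elim _ _, fun x => Subsingleton.elim _ _,
    fun v x => Subsingleton.elim _ _⟩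

theorem FinDim.of_iso {M N : DRep k m} (hM : M.FinDim) (e : Iso M N) : N.FinDim := by
  obtain ⟨_, _, _⟩ := hM
  exact ⟨e.g1.finiteDimensional, e.g2.finiteDimensional, fun v => (e.gA v).finiteDimensional⟩

theorem FinDim.left_of_prod {M N : DRep k m} (h : (M.prod N).FinDim) : M.FinDim := by
  have h₁ : Module.Finite k (M.T1 × N.T1) := h.1
  have h₂ : Module.Finite k (M.T2 × N.T2) := h.2.1
  have h₃ : ∀ v, Module.Finite k (M.A v × N.A v) := h.2.2
  exact ⟨Module.Finite.of_surjective (LinearMap.fst k M.T1 N.T1) Prod.fst_surjective,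
    Module.Finite.of_surjective (LinearMap.fst k M.T2 N.T2) Prod.fst_surjective,
    fun v => Module.Finite.of_surjective (LinearMap.fst k (M.A v) (N.A v)) Prod.fst_surjective⟩

theorem FinDim.right_of_prod {M N : DRep k m} (h : (M.prod N).FinDim) : N.FinDim := by
  have h₁ : Module.Finite k (M.T1 × N.T1) := h.1
  have h₂ : Module.Finite k (M.T2 × N.T2) := h.2.1
  have h₃ : ∀ v, Module.Finite k (M.A v × N.A v) := h.2.2
  exact ⟨Module.Finite.of_surjective (LinearMap.snd k M.T1 N.T1) Prod.snd_surjective,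
    Module.Finite.of_surjective (LinearMap.snd k M.T2 N.T2) Prod.snd_surjective,
    fun v => Module.Finite.of_surjective (LinearMap.snd k (M.A v) (N.A v)) Prod.snd_surjective⟩

theorem Iso.totalDim_eq {M N : DRep k m} (e : Iso M N) : M.totalDim = N.totalDim := by
  simp only [totalDim, e.g1.finrank_eq, e.g2.finrank_eq, fun v => (e.gA v).finrank_eq]

theorem totalDim_prod {M N : DRep k m} (hM : M.FinDim) (hN : N.FinDim) :
    (M.prod N).totalDim = M.totalDim + N.totalDim := by
  obtain ⟨_, _, _⟩ := hM
  obtain ⟨_, _, _⟩ := hN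
  have h₁ : Module.finrank k (M.prod N).T1 = _ :=
    Module.finrank_prod (R := k) (M := M.T1) (M' := N.T1)
  have h₂ : Module.finrank k (M.prod N).T2 = _ :=
    Module.finrank_prod (R := k) (M := M.T2) (M' := N.T2)
  have h₃ : ∀ v, Module.finrank k ((M.prod N).A v) = _ := fun v =>
    Module.finrank_prod (R := k) (M := M.A v) (M' := N.A v)
  simp only [totalDim, h₁, h₂, h₃, Finset.sum_add_distrib]
  omega

/-- Every finite-dimensional representation is a direct sum of finite-dimensional indecomposable
ones. -/
theorem FinDim.isDsumOf_indecomposable {M : DRep k m} (hM : M.FinDim) :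
    M.IsDsumOf fun N => N.FinDim ∧ N.Indecomposable := by
  induction h : M.totalDim using Nat.strong_induction_on generalizing M with
  | _ n ih =>
    by_cases hzero : M.IsZero
    · exact hzero.isDsumOf _
    by_cases hind : M.Indecomposable
    · exact ⟨Unit, fun _ => M, fun _ => ⟨hM, hind⟩, ⟨isoDsumUnit M⟩⟩
    have hdec : ∃ N₁ N₂ : DRep k m, Nonempty (Iso M (N₁.prod N₂)) ∧ ¬ N₁.IsZero ∧ ¬ N₂.IsZero := by
      by_contra hcon
      refine hind ⟨hzero, fun N₁ N₂ e => ?_⟩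
      by_contra hN
      exact hcon ⟨N₁, N₂, e, not_or.1 hN⟩
    obtain ⟨N₁, N₂, ⟨e⟩, h₁, h₂⟩ := hdec
    have hf₁ := (hM.of_iso e).left_of_prod
    have hf₂ := (hM.of_iso e).right_of_prod
    have hdim := e.totalDim_eq.trans (totalDim_prod hf₁ hf₂)
    have hpos₁ := totalDim_pos hf₁ h₁
    have hpos₂ := totalDim_pos hf₂ h₂
    have hpair : M.IsDsumOf fun N => N = N₁ ∨ N = N₂ := by
      refine ⟨Fin 2, pairFamily N₁ N₂, fun i => ?_, ⟨e.trans (prodIsoDsum N₁ N₂)⟩⟩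
      fin_cases i
      exacts [Or.inl rfl, Or.inr rfl]
    refine hpair.bind ?_
    rintro N (rfl | rfl)
    · exact ih _ (by omega) hf₁ rfl
    · exact ih _ (by omega) hf₂ rfl

theorem coeLinearMap_toModule_restrict {ι V W : Type} [DecidableEq ι] [AddCommGroup V]
    [Module k V] [AddCommGroup W] [Module k W] (S : ι → Submodule k V) (T : ι → Submodule k W)
    (φ : V →ₗ[k] W) (hφ : ∀ i, ∀ x ∈ S i, φ x ∈ T i) (x : DirectSum ι fun i => S i) :
    DirectSum.coeLinearMap T (DirectSum.toModule k ι (DirectSum ι fun i => T i)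
      (fun i => (DirectSum.lof k ι (fun j => T j) i).comp (φ.restrict (hφ i))) x) =
      φ (DirectSum.coeLinearMap S x) := by
  have h : DirectSum.coeLinearMap T ∘ₗ DirectSum.toModule k ι (DirectSum ι fun i => T i)
      (fun i => (DirectSum.lof k ι (fun j => T j) i).comp (φ.restrict (hφ i))) =
      φ ∘ₗ DirectSum.coeLinearMap S := by
    ext i y
    simp
  exact LinearMap.congr_fun h x

/-- Every representation is a direct sum of finite-dimensional ones. -/
theorem isDsumOf_finDim (M : DRep k m) : M.IsDsumOf FinDim := by
  obtain ⟨ι, S₁, S₂, S, hS₁, hS₂, hS, hp₁, hp₂, hf⟩ := M.finDecomp_top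
  let F : ι → DRep k m := fun i =>
    { T1 := S₁ i
      T2 := S₂ i
      A := fun v => S v i
      p1 := M.p1.restrict (hp₁ i)
      p2 := M.p2.restrict (hp₂ i)
      f := fun j => (M.f j).restrict (hf i j) }
  refine ⟨ι, F, fun i => ⟨hS₁.2.2 i, hS₂.2.2 i, fun v => (hS v).2.2 i⟩, ?_⟩
  let := Classical.decEq ι
  have h₁ := DirectSum.isInternal_submodule_of_iSupIndep_of_iSup_eq_top hS₁.1 hS₁.2.1
  have h₂ := DirectSum.isInternal_submodule_of_iSupIndep_of_iSup_eq_top hS₂.1 hS₂.2.1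
  have h := fun v => DirectSum.isInternal_submodule_of_iSupIndep_of_iSup_eq_top (hS v).1 (hS v).2.1
  have e : Iso (dsum F) M :=
    { g1 := LinearEquiv.ofBijective (DirectSum.coeLinearMap S₁) h₁
      g2 := LinearEquiv.ofBijective (DirectSum.coeLinearMap S₂) h₂
      gA := fun v => LinearEquiv.ofBijective (DirectSum.coeLinearMap (S v)) (h v)
      comm1 := coeLinearMap_toModule_restrict _ _ M.p1 hp₁
      comm2 := coeLinearMap_toModule_restrict _ _ M.p2 hp₂
      commf := fun j => coeLinearMap_toModule_restrict _ _ (M.f j) fun i => hf i j }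
  exact ⟨e.symm⟩

end External

end DRep

/-- Every (possibly infinite-dimensional) representation of the quiver
`Q(n)` of type `D_n` (`n = m + 3 ≥ 3`) is a direct sum of finite-dimensional
indecomposable representations. -/
theorem stmt13 (k : Type) [Field k] (m : ℕ) (M : DRep k m) :
    ∃ (ι : Type) (F : ι → DRep k m),
      (∀ i, (F i).FinDim ∧ (F i).Indecomposable) ∧
      Nonempty (DRep.Iso M (DRep.dsum F)) :=
  M.isDsumOf_finDim.bind fun _ hN => hN.isDsumOf_indecomposable
end

section
/- Let Q be a finite connected quiver whose underlying graph contains no subgraph of Euclidean type (no cycle Ã_m, no vertex of degree ≥ 4 forming D̃_4, no two branching vertices forming D̃_m with m ≥ 5, no subgraph of type Ẽ_6, Ẽ_7, or Ẽ_8). Then the underlying graph of Q is a Dynkin graph of type A_n, D_n, E_6, E_7, or E_8. -/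
/-- `G` contains a subgraph of the shape `H`: an injective map of vertices carrying edges
of `H` to edges of `G`. -/
def ContainsCopy {V : Type} (G : SimpleGraph V) {N : ℕ} (H : SimpleGraph (Fin N)) : Prop :=
  ∃ φ : Fin N → V, Function.Injective φ ∧ ∀ i j, H.Adj i j → G.Adj (φ i) (φ j)

/-- The graph on `Fin N` with the given list of edges. -/
def listGraph {N : ℕ} (l : List (Fin N × Fin N)) : SimpleGraph (Fin N) :=
  SimpleGraph.fromRel fun a b => (a, b) ∈ l

/-- The Euclidean graph `Ẽ₆` (star with arms of lengths `3,3,3` counting the center). -/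
def eTilde6 : SimpleGraph (Fin 7) :=
  listGraph [(0, 1), (1, 2), (2, 3), (3, 4), (2, 5), (5, 6)]

/-- The Euclidean graph `Ẽ₇` (star with arms of lengths `4,4,2`). -/
def eTilde7 : SimpleGraph (Fin 8) :=
  listGraph [(0, 1), (1, 2), (2, 3), (3, 4), (4, 5), (5, 6), (3, 7)]

/-- The Euclidean graph `Ẽ₈` (star with arms of lengths `6,3,2`). -/
def eTilde8 : SimpleGraph (Fin 9) :=
  listGraph [(0, 1), (1, 2), (2, 3), (3, 4), (4, 5), (5, 6), (6, 7), (2, 8)]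

/-- The Dynkin graph `D_n`: a path `1 - 2 - ⋯ - (n-1)` with the extra leaf `0` attached
at vertex `2`. -/
def dynkinD (n : ℕ) : SimpleGraph (Fin n) :=
  SimpleGraph.fromRel fun a b =>
    (a.val + 1 = b.val ∧ 1 ≤ a.val) ∨ (a.val = 0 ∧ b.val = 2)

/-- The Dynkin graphs `E₆, E₇, E₈` (for `n = 6, 7, 8`): a path `0 - 1 - ⋯ - (n-2)` with the
extra leaf `n-1` attached at vertex `2`. -/
def dynkinE (n : ℕ) : SimpleGraph (Fin n) :=
  SimpleGraph.fromRel fun a b =>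
    (a.val + 1 = b.val ∧ b.val ≤ n - 2) ∨ (a.val = n - 1 ∧ b.val = 2)

namespace SimpleGraph

variable {V : Type} {G : SimpleGraph V}

/-- The vertices `x 0, …, x m` are pairwise distinct and consecutive ones are adjacent. -/
structure IsPathSeq (G : SimpleGraph V) (m : ℕ) (x : ℕ → V) : Prop where
  adj : ∀ i < m, G.Adj (x i) (x (i + 1))
  inj : ∀ i ≤ m, ∀ j ≤ m, x i = x j → i = j

namespace IsPathSeq

variable {m : ℕ} {x : ℕ → V}

lemma adj_of_succ_eq (h : IsPathSeq G m x) {i j : ℕ} (hij : i + 1 = j) (hj : j ≤ m) :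
    G.Adj (x i) (x j) := by
  subst hij
  exact h.adj i hj

lemma reverse (h : IsPathSeq G m x) : IsPathSeq G m (fun i => x (m - i)) where
  adj i hi := (h.adj_of_succ_eq (by omega) (by omega)).symm
  inj i hi j hj hij := by
    have := h.inj _ (by omega) _ (by omega) hij
    omega

lemma cons (h : IsPathSeq G m x) {y : V} (hy : ∀ i ≤ m, x i ≠ y) (hadj : G.Adj y (x 0)) :
    IsPathSeq G (m + 1) (fun i => if i = 0 then y else x (i - 1)) where
  adj i hi := by
    rcases Nat.eq_zero_or_pos i with rfl | hi0
    · simpa using hadj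
    · simpa [hi0.ne'] using h.adj_of_succ_eq (i := i - 1) (j := i) (by omega) (by omega)
  inj i hi j hj hij := by
    by_cases hi0 : i = 0 <;> by_cases hj0 : j = 0 <;> simp only [hi0, hj0, if_true, if_false] at hij
    · omega
    · exact absurd hij.symm (hy _ (by omega))
    · exact absurd hij (hy _ (by omega))
    · have := h.inj _ (by omega) _ (by omega) hij
      omega

/-- Replace the initial vertex. -/
lemma update_zero (h : IsPathSeq G m x) {y : V} (hy : ∀ i ≤ m, x i ≠ y)
    (hadj : G.Adj y (x 1)) : IsPathSeq G m (fun i => if i = 0 then y else x i) where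
  adj i hi := by
    rcases Nat.eq_zero_or_pos i with rfl | hi0
    · simpa using hadj
    · simpa [hi0.ne'] using h.adj i hi
  inj i hi j hj hij := by
    by_cases hi0 : i = 0 <;> by_cases hj0 : j = 0 <;> simp only [hi0, hj0, if_true, if_false] at hij
    · omega
    · exact absurd hij.symm (hy _ hj)
    · exact absurd hij (hy _ hi)
    · exact h.inj _ hi _ hj hij

end IsPathSeq

lemma exists_maximal_isPathSeq [Fintype V] [Nonempty V] (G : SimpleGraph V) :
    ∃ m x, IsPathSeq G m x ∧ ∀ m' x', IsPathSeq G m' x' → m' ≤ m := by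
  let S : Set ℕ := {m | ∃ x, IsPathSeq G m x}
  have hne : S.Nonempty := ⟨0, fun _ => Classical.arbitrary V, by simp, by simp⟩
  have hb : BddAbove S := by
    refine ⟨Fintype.card V, ?_⟩
    rintro m ⟨x, hx⟩
    have hinj : Function.Injective (fun i : Fin (m + 1) => x i) := fun i j hij =>
      Fin.ext (hx.inj _ (by omega) _ (by omega) hij)
    have := Fintype.card_le_of_injective _ hinj
    simp at this
    omega
  obtain ⟨x, hx⟩ := Nat.sSup_mem hne hb
  exact ⟨_, x, hx, fun m' x' h' => le_csSup hb ⟨x', h'⟩⟩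

lemma Connected.exists_adj_mem_notMem (hG : G.Connected) {S : Set V} {a b : V} (ha : a ∈ S)
    (hb : b ∉ S) : ∃ c ∈ S, ∃ d ∉ S, G.Adj c d := by
  obtain ⟨p⟩ := hG.preconnected a b
  obtain ⟨d, -, h1, h2⟩ := p.exists_boundary_dart S ha hb
  exact ⟨_, h1, _, h2, d.adj⟩

/-- A bijective homomorphism from a connected graph to an acyclic graph is an isomorphism. -/
lemma nonempty_iso_of_bijective {W : Type} {H : SimpleGraph W} (hG : G.IsAcyclic)
    (hH : H.Preconnected) (φ : W → V) (hφ : Function.Bijective φ)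
    (hadj : ∀ i j, H.Adj i j → G.Adj (φ i) (φ j)) : Nonempty (G ≃g H) := by
  refine ⟨(RelIso.mk (Equiv.ofBijective φ hφ) ?_ : H ≃g G).symm⟩
  intro i j
  refine ⟨fun h => ?_, hadj i j⟩
  by_contra hn
  have hb := isAcyclic_iff_forall_adj_isBridge.mp hG h
  rw [isBridge_iff] at hb
  refine hb ((hH i j).map ⟨φ, ?_⟩)
  intro a b hab
  rw [deleteEdges_adj]
  refine ⟨hadj _ _ hab, ?_⟩
  simp only [Equiv.ofBijective_apply, Set.mem_singleton_iff, Sym2.eq_iff, hφ.1.eq_iff]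
  rintro (⟨rfl, rfl⟩ | ⟨rfl, rfl⟩)
  · exact hn hab
  · exact hn hab.symm

lemma three_le_ncard_neighborSet [Finite V] {v a b c : V} (ha : G.Adj v a) (hb : G.Adj v b)
    (hc : G.Adj v c) (hab : a ≠ b) (hac : a ≠ c) (hbc : b ≠ c) :
    3 ≤ (G.neighborSet v).ncard := by
  rw [← Set.ncard_eq_three.mpr ⟨a, b, c, hab, hac, hbc, rfl⟩]
  refine Set.ncard_le_ncard ?_ (Set.toFinite _)
  rintro _ (rfl | rfl | rfl) <;> assumption

lemma four_le_ncard_neighborSet [Finite V] {v a b c d : V} (ha : G.Adj v a) (hb : G.Adj v b)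
    (hc : G.Adj v c) (hd : G.Adj v d) (hab : a ≠ b) (hac : a ≠ c) (hbc : b ≠ c)
    (had : a ≠ d) (hbd : b ≠ d) (hcd : c ≠ d) :
    4 ≤ (G.neighborSet v).ncard := by
  have h3 : ({a, b, c} : Set V).ncard = 3 := Set.ncard_eq_three.mpr ⟨a, b, c, hab, hac, hbc, rfl⟩
  have h4 : (insert d ({a, b, c} : Set V)).ncard = 4 := by
    rw [Set.ncard_insert_of_notMem (by simp [had.symm, hbd.symm, hcd.symm]), h3]
  rw [← h4]
  refine Set.ncard_le_ncard ?_ (Set.toFinite _)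
  rintro _ (rfl | rfl | rfl | rfl) <;> assumption

end SimpleGraph

open SimpleGraph

lemma containsCopy_listGraph {V : Type} {G : SimpleGraph V} {N : ℕ} {l : List (Fin N × Fin N)}
    (φ : Fin N → V) (hφ : Function.Injective φ) (h : ∀ p ∈ l, G.Adj (φ p.1) (φ p.2)) :
    ContainsCopy G (listGraph l) := by
  refine ⟨φ, hφ, fun i j hij => ?_⟩
  obtain ⟨-, h1 | h1⟩ := hij
  · exact h _ h1
  · exact (h _ h1).symm

lemma dynkinD_preconnected (n : ℕ) (hn : 4 ≤ n) : (dynkinD n).Preconnected := by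
  have h0 : ∀ i (hi : i < n), 1 ≤ i → (dynkinD n).Reachable ⟨1, by omega⟩ ⟨i, hi⟩ := by
    intro i hi h1
    induction i, h1 using Nat.le_induction with
    | base => rfl
    | succ i h1 ih =>
      refine (ih (by omega)).trans (Adj.reachable ⟨by simp, Or.inl (Or.inl ⟨rfl, h1⟩)⟩)
  have h2 : ∀ i, (dynkinD n).Reachable ⟨1, by omega⟩ i := by
    rintro ⟨i, hi⟩
    rcases Nat.eq_zero_or_pos i with rfl | hi0
    · exact (h0 2 (by omega) (by omega)).trans
        (Adj.reachable ⟨by simp, Or.inr (Or.inr ⟨rfl, rfl⟩)⟩)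
    · exact h0 i hi hi0
  exact fun i j => (h2 i).symm.trans (h2 j)

lemma dynkinE_preconnected (n : ℕ) (hn : 4 ≤ n) : (dynkinE n).Preconnected := by
  have h0 : ∀ i (hi : i < n), i ≤ n - 2 → (dynkinE n).Reachable ⟨0, by omega⟩ ⟨i, hi⟩ := by
    intro i hi h1
    induction i with
    | zero => rfl
    | succ i ih =>
      refine (ih (by omega) (by omega)).trans (Adj.reachable ⟨by simp, Or.inl (Or.inl ⟨rfl, h1⟩)⟩)
  have h2 : ∀ i, (dynkinE n).Reachable ⟨0, by omega⟩ i := by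
    rintro ⟨i, hi⟩
    by_cases hi0 : i ≤ n - 2
    · exact h0 i hi hi0
    · exact (h0 2 (by omega) (by omega)).trans
        (Adj.reachable ⟨by simp; omega, Or.inr (Or.inr ⟨by simp; omega, rfl⟩)⟩)
  exact fun i j => (h2 i).symm.trans (h2 j)

namespace SimpleGraph.IsPathSeq

variable {V : Type} {G : SimpleGraph V} {m k : ℕ} {x : ℕ → V} {y : V}

lemma nonempty_iso_pathGraph (hx : IsPathSeq G m x) (hG : G.IsAcyclic)
    (hcov : ∀ v, ∃ i ≤ m, x i = v) : Nonempty (G ≃g pathGraph (m + 1)) := by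
  refine nonempty_iso_of_bijective hG (pathGraph_connected m).preconnected (fun i => x i)
    ⟨fun i j hij => Fin.ext (hx.inj _ (by omega) _ (by omega) hij), fun v => ?_⟩ ?_
  · obtain ⟨i, hi, rfl⟩ := hcov v
    exact ⟨⟨i, by omega⟩, rfl⟩
  · intro i j hij
    rw [pathGraph_adj] at hij
    rcases hij with h | h
    · exact hx.adj_of_succ_eq h (by omega)
    · exact (hx.adj_of_succ_eq h (by omega)).symm

lemma nonempty_iso_dynkinD (hx : IsPathSeq G m x) (hG : G.IsAcyclic) (hm : 2 ≤ m)
    (hy : ∀ i ≤ m, x i ≠ y) (hadj : G.Adj (x 1) y)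
    (hcov : ∀ v, v = y ∨ ∃ i ≤ m, x i = v) : Nonempty (G ≃g dynkinD (m + 2)) := by
  refine nonempty_iso_of_bijective hG (dynkinD_preconnected _ (by omega))
    (fun i => if i.val = 0 then y else x (i.val - 1)) ⟨fun i j hij => ?_, fun v => ?_⟩ ?_
  · dsimp only at hij
    split_ifs at hij
    · omega
    · exact absurd hij.symm (hy _ (by omega))
    · exact absurd hij (hy _ (by omega))
    · have := hx.inj _ (by omega) _ (by omega) hij
      omega
  · rcases hcov v with rfl | ⟨i, hi, rfl⟩
    · exact ⟨⟨0, by omega⟩, by simp⟩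
    · exact ⟨⟨i + 1, by omega⟩, by simp⟩
  · have key : ∀ i j : Fin (m + 2), (i.val + 1 = j.val ∧ 1 ≤ i.val) ∨ (i.val = 0 ∧ j.val = 2) →
        G.Adj (if i.val = 0 then y else x (i.val - 1)) (if j.val = 0 then y else x (j.val - 1)) := by
      rintro i j (⟨h1, h2⟩ | ⟨h1, h2⟩)
      · rw [if_neg (by omega), if_neg (by omega)]
        exact hx.adj_of_succ_eq (by omega) (by omega)
      · simpa [h1, h2] using hadj.symm
    rintro i j ⟨-, h | h⟩
    · exact key i j h
    · exact (key j i h).symm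

lemma nonempty_iso_dynkinE (hx : IsPathSeq G m x) (hG : G.IsAcyclic) (hm : 2 ≤ m)
    (hy : ∀ i ≤ m, x i ≠ y) (hadj : G.Adj (x 2) y)
    (hcov : ∀ v, v = y ∨ ∃ i ≤ m, x i = v) : Nonempty (G ≃g dynkinE (m + 2)) := by
  refine nonempty_iso_of_bijective hG (dynkinE_preconnected _ (by omega))
    (fun i => if i.val = m + 1 then y else x i.val) ⟨fun i j hij => ?_, fun v => ?_⟩ ?_
  · dsimp only at hij
    split_ifs at hij
    · omega
    · exact absurd hij.symm (hy _ (by omega))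
    · exact absurd hij (hy _ (by omega))
    · exact Fin.ext (hx.inj _ (by omega) _ (by omega) hij)
  · rcases hcov v with rfl | ⟨i, hi, rfl⟩
    · exact ⟨⟨m + 1, by omega⟩, by simp⟩
    · exact ⟨⟨i, by omega⟩, by simp; omega⟩
  · have key : ∀ i j : Fin (m + 2),
        (i.val + 1 = j.val ∧ j.val ≤ m + 2 - 2) ∨ (i.val = m + 2 - 1 ∧ j.val = 2) →
        G.Adj (if i.val = m + 1 then y else x i.val) (if j.val = m + 1 then y else x j.val) := by
      rintro i j (⟨h1, h2⟩ | ⟨h1, h2⟩)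
      · rw [if_neg (by omega), if_neg (by omega)]
        exact hx.adj_of_succ_eq h1 (by omega)
      · rw [if_pos (by omega), if_neg (by omega), h2]
        exact hadj.symm
    rintro i j ⟨-, h | h⟩
    · exact key i j h
    · exact (key j i h).symm

lemma containsCopy_eTilde6 {z : V} (hx : IsPathSeq G m x) (hk : 2 ≤ k) (hkm : k + 2 ≤ m)
    (hy : ∀ i ≤ m, x i ≠ y) (hz : ∀ i ≤ m, x i ≠ z) (hyz : G.Adj y z) (hadj : G.Adj (x k) y) :
    ContainsCopy G eTilde6 := by
  obtain ⟨c, rfl⟩ := Nat.exists_eq_add_of_le' hk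
  have hzy := hyz.ne
  refine containsCopy_listGraph
    (fun i => if i.val = 6 then z else if i.val = 5 then y else x (c + i.val)) ?_ ?_
  · intro i j hij
    dsimp only at hij
    split_ifs at hij
    on_goal 9 => have := hx.inj _ (by omega) _ (by omega) hij
    all_goals first
      | omega
      | exact absurd hij hzy
      | exact absurd hij.symm hzy
      | exact absurd hij (hy _ (by omega))
      | exact absurd hij.symm (hy _ (by omega))
      | exact absurd hij (hz _ (by omega))
      | exact absurd hij.symm (hz _ (by omega))
  · have h (i : ℕ) (hi : i < 4) : G.Adj (x (c + i)) (x (c + (i + 1))) := hx.adj _ (by omega)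
    simpa [hyz, hadj] using ⟨h 0 (by omega), h 1 (by omega), h 2 (by omega), h 3 (by omega)⟩

lemma containsCopy_eTilde7 (hx : IsPathSeq G m x) (hk : 3 ≤ k) (hkm : k + 3 ≤ m)
    (hy : ∀ i ≤ m, x i ≠ y) (hadj : G.Adj (x k) y) : ContainsCopy G eTilde7 := by
  obtain ⟨c, rfl⟩ := Nat.exists_eq_add_of_le' hk
  refine containsCopy_listGraph (fun i => if i.val = 7 then y else x (c + i.val)) ?_ ?_
  · intro i j hij
    dsimp only at hij
    split_ifs at hij
    · omega
    · exact absurd hij.symm (hy _ (by omega))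
    · exact absurd hij (hy _ (by omega))
    · have := hx.inj _ (by omega) _ (by omega) hij
      omega
  · have h (i : ℕ) (hi : i < 6) : G.Adj (x (c + i)) (x (c + (i + 1))) := hx.adj _ (by omega)
    simpa [hadj] using ⟨h 0 (by omega), h 1 (by omega), h 2 (by omega), h 3 (by omega),
      h 4 (by omega), h 5 (by omega)⟩

lemma containsCopy_eTilde8 (hx : IsPathSeq G m x) (hm : 7 ≤ m)
    (hy : ∀ i ≤ m, x i ≠ y) (hadj : G.Adj (x 2) y) : ContainsCopy G eTilde8 := by
  refine containsCopy_listGraph (fun i => if i.val = 8 then y else x i.val) ?_ ?_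
  · intro i j hij
    dsimp only at hij
    split_ifs at hij
    · omega
    · exact absurd hij.symm (hy _ (by omega))
    · exact absurd hij (hy _ (by omega))
    · exact Fin.ext (hx.inj _ (by omega) _ (by omega) hij)
  · have h (i : ℕ) (hi : i < 7) : G.Adj (x i) (x (i + 1)) := hx.adj _ (by omega)
    simpa [hadj] using ⟨h 0 (by omega), h 1 (by omega), h 2 (by omega), h 3 (by omega),
      h 4 (by omega), h 5 (by omega), h 6 (by omega)⟩

/-- A neighbour outside a longest path is attached to an inner vertex of that path. -/
lemma pos_and_lt_of_adj (hx : IsPathSeq G m x) (hmax : ∀ m' x', IsPathSeq G m' x' → m' ≤ m)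
    (hy : ∀ i ≤ m, x i ≠ y) (hkm : k ≤ m) (hadj : G.Adj (x k) y) : 0 < k ∧ k < m := by
  constructor
  · refine Nat.pos_of_ne_zero ?_
    rintro rfl
    have := hmax _ _ (hx.cons hy hadj.symm)
    omega
  · refine lt_of_le_of_ne hkm ?_
    rintro rfl
    have := hmax _ _ (hx.reverse.cons (y := y) (fun i _ => hy _ (by omega))
      (by simpa using hadj.symm))
    omega

lemma three_le_ncard_neighborSet [Finite V] (hx : IsPathSeq G m x) (hk : 0 < k) (hkm : k < m)
    (hy : ∀ i ≤ m, x i ≠ y) (hadj : G.Adj (x k) y) : 3 ≤ (G.neighborSet (x k)).ncard :=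
  SimpleGraph.three_le_ncard_neighborSet
    (hx.adj_of_succ_eq (i := k - 1) (by omega) (by omega)).symm (hx.adj k hkm) hadj
    (fun h => by have := hx.inj _ (by omega) _ (by omega) h; omega)
    (hy _ (by omega)) (hy _ (by omega))

/-- A longest path together with one further vertex attached to it covers the graph. -/
lemma eq_or_exists_eq_of_adj [Finite V] (hx : IsPathSeq G m x)
    (hmax : ∀ m' x', IsPathSeq G m' x' → m' ≤ m) (hconn : G.Connected)
    (hdeg : ∀ v : V, (G.neighborSet v).ncard ≤ 3)
    (hbranch : ∀ v w : V, 3 ≤ (G.neighborSet v).ncard → 3 ≤ (G.neighborSet w).ncard → v = w)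
    (hE6 : ¬ ContainsCopy G eTilde6) (hk : 0 < k) (hkm : k ≤ m - k)
    (hy : ∀ i ≤ m, x i ≠ y) (hadj : G.Adj (x k) y) (v : V) :
    v = y ∨ ∃ i ≤ m, x i = v := by
  by_contra hv
  obtain ⟨c, hc, z, hz, hcz⟩ := hconn.exists_adj_mem_notMem
    (S := {v | v = y ∨ ∃ i ≤ m, x i = v}) (Or.inl rfl : y ∈ _) hv
  simp only [Set.mem_ofPred_eq, not_or, not_exists, not_and] at hz
  obtain ⟨hzy, hz⟩ := hz
  rcases hc with rfl | ⟨j, hj, rfl⟩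
  · rcases Nat.lt_or_ge k 2 with hk2 | hk2
    · obtain rfl : k = 1 := by omega
      have := hmax _ _ ((hx.update_zero hy hadj.symm).cons (y := z)
        (fun i hi => by
          split_ifs
          exacts [Ne.symm hzy, hz i hi])
        (by simpa using hcz.symm))
      omega
    · exact hE6 (hx.containsCopy_eTilde6 hk2 (by omega) hy hz hcz hadj)
  · obtain ⟨hj0, hjm⟩ := hx.pos_and_lt_of_adj hmax hz hj hcz
    have hjk := hx.inj _ (by omega) _ (by omega) <| hbranch _ _
      (hx.three_le_ncard_neighborSet hj0 hjm hz hcz)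
      (hx.three_le_ncard_neighborSet hk (by omega) hy hadj)
    subst hjk
    have := four_le_ncard_neighborSet
      (hx.adj_of_succ_eq (i := j - 1) (by omega) (by omega)).symm (hx.adj j hjm) hadj hcz
      (fun h => by have := hx.inj _ (by omega) _ (by omega) h; omega)
      (hy _ (by omega)) (hy _ (by omega)) (hz _ (by omega)) (hz _ (by omega)) (Ne.symm hzy)
    have := hdeg (x j)
    omega

end SimpleGraph.IsPathSeq

theorem isDynkin_of_isTree {V : Type} [Fintype V] {G : SimpleGraph V} (hconn : G.Connected)
    (hacyc : G.IsAcyclic) (hdeg : ∀ v : V, (G.neighborSet v).ncard ≤ 3)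
    (hbranch : ∀ v w : V, 3 ≤ (G.neighborSet v).ncard → 3 ≤ (G.neighborSet w).ncard → v = w)
    (hE6 : ¬ ContainsCopy G eTilde6) (hE7 : ¬ ContainsCopy G eTilde7)
    (hE8 : ¬ ContainsCopy G eTilde8) :
    (∃ n : ℕ, Nonempty (G ≃g pathGraph n)) ∨ (∃ n : ℕ, 4 ≤ n ∧ Nonempty (G ≃g dynkinD n)) ∨
    Nonempty (G ≃g dynkinE 6) ∨ Nonempty (G ≃g dynkinE 7) ∨ Nonempty (G ≃g dynkinE 8) := by
  have := hconn.nonempty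
  obtain ⟨m, x, hx, hmax⟩ := exists_maximal_isPathSeq G
  by_cases hcov : ∀ v, ∃ i ≤ m, x i = v
  · exact Or.inl ⟨_, hx.nonempty_iso_pathGraph hacyc hcov⟩
  right
  push Not at hcov
  obtain ⟨v, hv⟩ := hcov
  obtain ⟨-, ⟨k, hkm, rfl⟩, y, hy, hadj⟩ := hconn.exists_adj_mem_notMem
    (S := {v | ∃ i ≤ m, x i = v}) (a := x 0) (b := v) ⟨0, by omega, rfl⟩ (by simpa using hv)
  replace hy : ∀ i ≤ m, x i ≠ y := by simpa using hy
  wlog hle : k ≤ m - k generalizing x k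
  · exact this _ hx.reverse (fun i _ => hv _ (by omega)) (m - k) (by omega)
      (by simpa [Nat.sub_sub_self hkm] using hadj) (fun i _ => hy _ (by omega)) (by omega)
  obtain ⟨hk0, hkm'⟩ := hx.pos_and_lt_of_adj hmax hy hkm hadj
  have hcov := hx.eq_or_exists_eq_of_adj hmax hconn hdeg hbranch hE6 hk0 hle hy hadj
  obtain rfl | rfl | hk3 : k = 1 ∨ k = 2 ∨ 3 ≤ k := by omega
  · exact Or.inl ⟨m + 2, by omega, hx.nonempty_iso_dynkinD hacyc (by omega) hy hadj hcov⟩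
  · right
    have hE := hx.nonempty_iso_dynkinE hacyc (by omega) hy hadj hcov
    have hm : m < 7 := by
      by_contra hm
      exact hE8 (hx.containsCopy_eTilde8 (by omega) hy hadj)
    obtain rfl | rfl | rfl : m = 4 ∨ m = 5 ∨ m = 6 := by omega
    exacts [Or.inl hE, Or.inr (Or.inl hE), Or.inr (Or.inr hE)]
  · exact absurd (hx.containsCopy_eTilde7 hk3 (by omega) hy hadj) hE7

/-- Let `Q` be a finite connected quiver whose underlying graph contains
no Euclidean subgraph: no loops (`Ã₀`), no multiple edges (`Ã₁`), no cycles (`Ã_m`), no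
vertex of degree `≥ 4` (`D̃₄`), no two branching vertices (`D̃_m`, `m ≥ 5`), and no subgraph
of type `Ẽ₆`, `Ẽ₇` or `Ẽ₈`. Then the underlying graph of `Q` is a Dynkin graph of type
`A_n`, `D_n`, `E₆`, `E₇` or `E₈`. -/
theorem stmt17 {V E : Type} [Fintype V] [Fintype E] (s t : E → V)
    (hconn : (underlying s t).Connected)
    (hloop : ∀ e, s e ≠ t e)
    (hmulti : ∀ e e' : E,
      (s e = s e' ∧ t e = t e') ∨ (s e = t e' ∧ t e = s e') → e = e')
    (hacyc : (underlying s t).IsAcyclic)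
    (hdeg : ∀ v : V, ((underlying s t).neighborSet v).ncard ≤ 3)
    (hbranch : ∀ v w : V, 3 ≤ ((underlying s t).neighborSet v).ncard →
      3 ≤ ((underlying s t).neighborSet w).ncard → v = w)
    (hE6 : ¬ ContainsCopy (underlying s t) eTilde6)
    (hE7 : ¬ ContainsCopy (underlying s t) eTilde7)
    (hE8 : ¬ ContainsCopy (underlying s t) eTilde8) :
    (∃ n : ℕ, Nonempty ((underlying s t) ≃g SimpleGraph.pathGraph n)) ∨
    (∃ n : ℕ, 4 ≤ n ∧ Nonempty ((underlying s t) ≃g dynkinD n)) ∨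
    Nonempty ((underlying s t) ≃g dynkinE 6) ∨
    Nonempty ((underlying s t) ≃g dynkinE 7) ∨
    Nonempty ((underlying s t) ≃g dynkinE 8) := by
  exact isDynkin_of_isTree hconn hacyc hdeg hbranch hE6 hE7 hE8
end
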